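/- arXiv:1603.04193 — 2 statements merged into one kernel-verified Lean document; each statement's English description precedes it below -/
import Mathlib

section
/- Let X ⊆ ℝⁿ be a central and irreducible real algebraic set and let f be a nonzero regulous function on X. The following are equivalent: (a) there exists a polynomial function p on X with sign(f) = sign(p) on X; (b) Z(f) is Zariski closed, i.e. a real algebraic subset of X; (c) X \ Z(f) = {x ∈ X : f(x)² > 0} is a principal open semi-algebraic set, i.e. equal to {x ∈ X : p(x) > 0} for some polynomial function p on X; (d) S(f²) ∩ Zar(Bd(S(f²))) = ∅, where S(f²) = {x ∈ X : f(x)² > 0}, Bd denotes the euclidean boundary in X, and Zar denotes the Zariski closure in X. -/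
open MvPolynomial Set

/-- A real algebraic set: the common zero locus of finitely many real polynomials. -/
def IsRealAlgebraicSet {n : ℕ} (X : Set (Fin n → ℝ)) : Prop :=
  ∃ (k : ℕ) (p : Fin k → MvPolynomial (Fin n) ℝ),
    X = {x | ∀ i, MvPolynomial.eval x (p i) = 0}

/-- `V` is a real algebraic subset of `X`, i.e. a Zariski closed subset of `X`. -/
def IsZariskiClosedIn {n : ℕ} (X V : Set (Fin n → ℝ)) : Prop :=
  IsRealAlgebraicSet V ∧ V ⊆ X

/-- `U` is a Zariski open subset of `X`. -/
def IsZariskiOpenIn {n : ℕ} (X U : Set (Fin n → ℝ)) : Prop :=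
  U ⊆ X ∧ IsRealAlgebraicSet (X \ U)

/-- `U` is Zariski dense in `X`. -/
def IsZariskiDenseIn {n : ℕ} (X U : Set (Fin n → ℝ)) : Prop :=
  ∀ V, IsZariskiClosedIn X V → U ⊆ V → V = X

/-- `f` is regular on `U` : on `U`, `f = p / q` with `q` nonvanishing on `U`. -/
def IsRegularOnSet {n : ℕ} (U : Set (Fin n → ℝ)) (f : (Fin n → ℝ) → ℝ) : Prop :=
  ∃ p q : MvPolynomial (Fin n) ℝ,
    (∀ x ∈ U, MvPolynomial.eval x q ≠ 0) ∧
    ∀ x ∈ U, f x = MvPolynomial.eval x p / MvPolynomial.eval x q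

/-- A rational continuous function on `X`: continuous on `X` (euclidean topology) and
regular on a Zariski-dense Zariski-open subset of `X`. -/
def IsRatCont {n : ℕ} (X : Set (Fin n → ℝ)) (f : (Fin n → ℝ) → ℝ) : Prop :=
  ContinuousOn f X ∧
    ∃ U, IsZariskiOpenIn X U ∧ IsZariskiDenseIn X U ∧ IsRegularOnSet U f

/-- A regulous function on `ℝⁿ`: continuous, and equal to a quotient of polynomials on a
nonempty Zariski open subset of `ℝⁿ`. -/
def IsRegulous {n : ℕ} (f : (Fin n → ℝ) → ℝ) : Prop :=
  Continuous f ∧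
    ∃ U : Set (Fin n → ℝ), IsZariskiOpenIn Set.univ U ∧ U.Nonempty ∧ IsRegularOnSet U f

/-- A regulous function on `X`: the restriction to `X` of a regulous function on `ℝⁿ`. -/
def IsRegulousOn {n : ℕ} (X : Set (Fin n → ℝ)) (f : (Fin n → ℝ) → ℝ) : Prop :=
  ∃ g : (Fin n → ℝ) → ℝ, IsRegulous g ∧ ∀ x ∈ X, f x = g x

/-- The largest Zariski open subset of `X` on which `f` is regular. -/
def regularDomain {n : ℕ} (X : Set (Fin n → ℝ)) (f : (Fin n → ℝ) → ℝ) : Set (Fin n → ℝ) :=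
  ⋃₀ {U | IsZariskiOpenIn X U ∧ IsRegularOnSet U f}

/-- The polar locus of `f` on `X`. -/
def polarLocus {n : ℕ} (X : Set (Fin n → ℝ)) (f : (Fin n → ℝ) → ℝ) : Set (Fin n → ℝ) :=
  X \ regularDomain X f

/-- The ideal of polynomials vanishing on `X`. -/
noncomputable def vanishingIdealOf {n : ℕ} (X : Set (Fin n → ℝ)) : Ideal (MvPolynomial (Fin n) ℝ) where
  carrier := {p | ∀ x ∈ X, MvPolynomial.eval x p = 0}
  add_mem' := by
    intro a b ha hb x hx
    simp [map_add, ha x hx, hb x hx]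
  zero_mem' := by intro x hx; simp
  smul_mem' := by
    intro c p hp x hx
    simp [smul_eq_mul, map_mul, hp x hx]

/-- The dimension of `X`: the Krull dimension of its coordinate ring. -/
noncomputable def algDim {n : ℕ} (X : Set (Fin n → ℝ)) : WithBot ℕ∞ :=
  ringKrullDim (MvPolynomial (Fin n) ℝ ⧸ vanishingIdealOf X)

/-- `x` is a regular (nonsingular) point of `X`: locally around `x`, `X` is the common zero
set of `n - d` polynomials (`d = dim X`) whose gradients at `x` are linearly independent. -/
def IsRegularPoint {n : ℕ} (X : Set (Fin n → ℝ)) (x : Fin n → ℝ) : Prop :=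
  x ∈ X ∧ ∃ d : ℕ, algDim X = (d : WithBot ℕ∞) ∧
    ∃ (p : Fin (n - d) → MvPolynomial (Fin n) ℝ) (U : Set (Fin n → ℝ)),
      IsOpen U ∧ x ∈ U ∧
      X ∩ U = {y ∈ U | ∀ j, MvPolynomial.eval y (p j) = 0} ∧
      LinearIndependent ℝ fun j : Fin (n - d) =>
        fun i : Fin n => MvPolynomial.eval x (MvPolynomial.pderiv i (p j))

/-- `X` is central: it is the euclidean closure of its set of regular points. -/
def IsCentral {n : ℕ} (X : Set (Fin n → ℝ)) : Prop :=
  closure {x | IsRegularPoint X x} = X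

/-- A semi-algebraic subset of `ℝᵐ`: a finite union of sets
`{x | p x = 0, q₁ x > 0, …, q_k x > 0}`. -/
def IsSemialgebraic {m : ℕ} (S : Set (Fin m → ℝ)) : Prop :=
  ∃ (N : ℕ) (P : Fin N → MvPolynomial (Fin m) ℝ) (k : Fin N → ℕ)
    (Q : (i : Fin N) → Fin (k i) → MvPolynomial (Fin m) ℝ),
    S = ⋃ i, {x | MvPolynomial.eval x (P i) = 0 ∧ ∀ j, 0 < MvPolynomial.eval x (Q i j)}

/-- The graph of `f : X → ℝ`, as a subset of `ℝⁿ⁺¹`. -/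
def graphOn {n : ℕ} (X : Set (Fin n → ℝ)) (f : (Fin n → ℝ) → ℝ) : Set (Fin (n + 1) → ℝ) :=
  {y | (fun i : Fin n => y i.castSucc) ∈ X ∧ y (Fin.last n) = f fun i : Fin n => y i.castSucc}

/-- `f` is a semi-algebraic function on `X`: its graph is semi-algebraic in `ℝⁿ⁺¹`. -/
def IsSemialgebraicFnOn {n : ℕ} (X : Set (Fin n → ℝ)) (f : (Fin n → ℝ) → ℝ) : Prop :=
  IsSemialgebraic (graphOn X f)

/-- The interior of `S` in `X` for the euclidean topology of `X`. -/
def interiorIn {n : ℕ} (X S : Set (Fin n → ℝ)) : Set (Fin n → ℝ) :=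
  {x ∈ X | ∃ U, IsOpen U ∧ x ∈ U ∧ U ∩ X ⊆ S}

/-- The euclidean boundary of `S` in `X`: closure of `S` in `X` minus interior of `S` in `X`. -/
def bdIn {n : ℕ} (X S : Set (Fin n → ℝ)) : Set (Fin n → ℝ) :=
  (closure S ∩ X) \ interiorIn X S

/-- The Zariski closure of `E` in `X`: the smallest real algebraic subset of `X`
containing `E`. -/
def zarClosureIn {n : ℕ} (X E : Set (Fin n → ℝ)) : Set (Fin n → ℝ) :=
  ⋂₀ {V | IsZariskiClosedIn X V ∧ E ⊆ V}

/-- `V` is a regulous closed subset of `X`: the zero set of a regulous function on `X`. -/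
def IsRegulousClosedIn {n : ℕ} (X V : Set (Fin n → ℝ)) : Prop :=
  ∃ f : (Fin n → ℝ) → ℝ, IsRegulousOn X f ∧ V = {x ∈ X | f x = 0}

/-- The regulous closure of `E` in `X`: the smallest regulous closed subset of `X`
containing `E`. -/
def regClosureIn {n : ℕ} (X E : Set (Fin n → ℝ)) : Set (Fin n → ℝ) :=
  ⋂₀ {V | IsRegulousClosedIn X V ∧ E ⊆ V}

/-- `X` is an irreducible real algebraic set: it is not the union of two proper real
algebraic subsets. -/
def IsIrreducibleAlgSet {n : ℕ} (X : Set (Fin n → ℝ)) : Prop :=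
  IsRealAlgebraicSet X ∧
    ∀ V W : Set (Fin n → ℝ), IsZariskiClosedIn X V → IsZariskiClosedIn X W →
      X = V ∪ W → V = X ∨ W = X

/-! ### One-variable sign matching -/

def TRel (G : Finset (ℝ × ℝ)) (y y' : ℝ) : Prop :=
  ∀ p ∈ G, (p.1 < y ↔ p.2 < y') ∧ (y < p.1 ↔ y' < p.2)

def TPI (G : Finset (ℝ × ℝ)) : Prop := ∀ p ∈ G, TRel G p.1 p.2

lemma TRel.eq_iff {G : Finset (ℝ × ℝ)} {y y' : ℝ} (h : TRel G y y') {p : ℝ × ℝ} (hp : p ∈ G) :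
    p.1 = y ↔ p.2 = y' := by
  have h1 := (h p hp).1
  have h2 := (h p hp).2
  constructor
  · intro e
    apply le_antisymm
    · by_contra hh
      have := h2.2 (not_le.1 hh)
      linarith
    · by_contra hh
      have := h1.2 (not_le.1 hh)
      linarith
  · intro e
    apply le_antisymm
    · by_contra hh
      have := h2.1 (not_le.1 hh)
      linarith
    · by_contra hh
      have := h1.1 (not_le.1 hh)
      linarith

lemma TPI.across {G : Finset (ℝ × ℝ)} (hG : TPI G) (y : ℝ) : ∃ y', TRel G y y' := by
  have key : ∀ p ∈ G, ∀ q ∈ G, cmp p.1 q.1 = cmp p.2 q.2 := by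
    intro p hp q hq
    have h := hG q hq p hp
    rcases lt_trichotomy p.1 q.1 with h1 | h1 | h1
    · rw [(cmp_eq_lt_iff _ _).2 h1, (cmp_eq_lt_iff _ _).2 (h.1.1 h1)]
    · rw [(cmp_eq_eq_iff _ _).2 h1, (cmp_eq_eq_iff _ _).2 (((hG q hq).eq_iff hp).1 h1)]
    · rw [(cmp_eq_gt_iff _ _).2 h1, (cmp_eq_gt_iff _ _).2 (h.2.1 h1)]
  obtain ⟨b, hb⟩ := Order.PartialIso.exists_across (⟨G, key⟩ : Order.PartialIso ℝ ℝ) y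
  refine ⟨b, fun p hp => ?_⟩
  have := hb p hp
  exact ⟨lt_iff_lt_of_cmp_eq_cmp this,
    lt_iff_lt_of_cmp_eq_cmp (cmp_eq_cmp_symm.1 this)⟩

lemma TRel.mono {G G' : Finset (ℝ × ℝ)} (h : G ⊆ G') {y y' : ℝ} (hr : TRel G' y y') :
    TRel G y y' := fun p hp => hr p (h hp)

noncomputable def Tswap (G : Finset (ℝ × ℝ)) : Finset (ℝ × ℝ) := G.image Prod.swap

lemma mem_Tswap {G : Finset (ℝ × ℝ)} {p : ℝ × ℝ} : p ∈ Tswap G ↔ (p.2, p.1) ∈ G := by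
  unfold Tswap
  rw [Finset.mem_image]
  constructor
  · rintro ⟨q, hq, rfl⟩; exact hq
  · intro h; exact ⟨_, h, rfl⟩

lemma TRel_swap {G : Finset (ℝ × ℝ)} {y y' : ℝ} : TRel (Tswap G) y' y ↔ TRel G y y' := by
  constructor
  · intro h p hp
    have := h (p.2, p.1) (mem_Tswap.2 hp)
    exact ⟨this.1.symm, this.2.symm⟩
  · intro h p hp
    have := h _ (mem_Tswap.1 hp)
    exact ⟨this.1.symm, this.2.symm⟩

lemma TPI.swap {G : Finset (ℝ × ℝ)} (hG : TPI G) : TPI (Tswap G) := by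
  intro p hp
  rw [TRel_swap]
  exact hG _ (mem_Tswap.1 hp)

noncomputable def Tneg (G : Finset (ℝ × ℝ)) : Finset (ℝ × ℝ) := G.image (fun p => (-p.1, -p.2))

lemma mem_Tneg {G : Finset (ℝ × ℝ)} {p : ℝ × ℝ} : p ∈ Tneg G ↔ (-p.1, -p.2) ∈ G := by
  unfold Tneg
  rw [Finset.mem_image]
  constructor
  · rintro ⟨q, hq, rfl⟩; simpa using hq
  · intro h; exact ⟨_, h, by simp⟩

lemma TRel_neg {G : Finset (ℝ × ℝ)} {y y' : ℝ} (h : TRel G y y') : TRel (Tneg G) (-y) (-y') := by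
  intro p hp
  have := h _ (mem_Tneg.1 hp)
  dsimp at this
  constructor
  · rw [lt_neg, this.2, lt_neg]
  · rw [neg_lt, this.1, neg_lt]

lemma TPI.neg {G : Finset (ℝ × ℝ)} (hG : TPI G) : TPI (Tneg G) := by
  intro p hp
  have := TRel_neg (hG _ (mem_Tneg.1 hp))
  simpa using this

lemma rootR {G : Finset (ℝ × ℝ)} (hG : TPI G) (F F' : ℝ → ℝ) (hF' : Continuous F') {y y' : ℝ}
    (hrel : TRel G y y')
    (h1 : 0 ≤ F y) (h2 : F' y' ≤ 0)
    (hs : ∀ p ∈ G, SignType.sign (F p.1) = SignType.sign (F' p.2))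
    (hmono : ∀ z > y, (∀ p ∈ G, ¬(y < p.1 ∧ p.1 < z)) → F y < F z)
    (hinf : (∀ p ∈ G, ¬ y' < p.2) → ∃ z > y', 0 < F' z) :
    ∃ ξ ≥ y', F' ξ = 0 ∧ ∀ p ∈ G, ¬(y' < p.2 ∧ p.2 ≤ ξ) := by
  by_cases hex : ∃ p ∈ G, y < p.1
  · obtain ⟨p0, hp0, hp0'⟩ := hex
    obtain ⟨p, hp, hmin⟩ := Finset.exists_min_image (G.filter (fun p => y < p.1)) (fun p => p.1)
      ⟨p0, Finset.mem_filter.2 ⟨hp0, hp0'⟩⟩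
    rw [Finset.mem_filter] at hp
    have hFp : 0 < F p.1 := lt_of_le_of_lt h1 (hmono p.1 hp.2 (by
      rintro q hq ⟨hq1, hq2⟩
      have := hmin q (Finset.mem_filter.2 ⟨hq, hq1⟩)
      linarith))
    have hFp' : 0 < F' p.2 := by
      have := hs p hp.1
      rw [sign_pos hFp] at this
      exact sign_eq_one_iff.1 this.symm
    have hlt : y' < p.2 := (hrel p hp.1).2.1 hp.2
    obtain ⟨ξ, hξ, hξ0⟩ := intermediate_value_Icc hlt.le hF'.continuousOn
      (show (0:ℝ) ∈ Icc (F' y') (F' p.2) from ⟨h2, hFp'.le⟩)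
    refine ⟨ξ, hξ.1, hξ0, ?_⟩
    rintro q hq ⟨hq1, hq2⟩
    have hξne : ξ ≠ p.2 := by rintro rfl; linarith
    have hξlt : ξ < p.2 := lt_of_le_of_ne hξ.2 hξne
    have a1 := (hrel q hq).2.2 hq1
    have a2 := hmin q (Finset.mem_filter.2 ⟨hq, a1⟩)
    have a3 := (hG p hp.1 q hq).1.2 (lt_of_le_of_lt hq2 hξlt)
    linarith
  · push Not at hex
    have hno : ∀ p ∈ G, ¬ y' < p.2 := by
      intro p hp h
      have := (hrel p hp).2.2 h
      have := hex p hp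
      linarith
    obtain ⟨z, hz, hz0⟩ := hinf hno
    obtain ⟨ξ, hξ, hξ0⟩ := intermediate_value_Icc (le_of_lt hz) hF'.continuousOn
      (show (0:ℝ) ∈ Icc (F' y') (F' z) from ⟨h2, hz0.le⟩)
    exact ⟨ξ, hξ.1, hξ0, fun p hp h => hno p hp h.1⟩

lemma rootBoth {G : Finset (ℝ × ℝ)} (hG : TPI G) (F F' : ℝ → ℝ) (hF : Continuous F)
    (hF' : Continuous F') {y y' : ℝ}
    (hrel : TRel G y y') (hy : ∀ p ∈ G, p.1 ≠ y)
    (h1 : 0 ≤ F y) (h2 : F' y' ≤ 0)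
    (hs : ∀ p ∈ G, SignType.sign (F p.1) = SignType.sign (F' p.2))
    (hmono : ∀ z > y, (∀ p ∈ G, ¬(y < p.1 ∧ p.1 < z)) → F y < F z)
    (hinf : (∀ p ∈ G, ¬ y' < p.2) → ∃ z > y', 0 < F' z)
    (hmono' : ∀ z < y', (∀ p ∈ G, ¬(z < p.2 ∧ p.2 < y')) → F' z < F' y')
    (hinf' : (∀ p ∈ G, ¬ p.1 < y) → ∃ z < y, F z < 0) :
    ∃ ξ ≤ y, ∃ ξ' ≥ y', F ξ = 0 ∧ F' ξ' = 0 ∧ TRel G ξ ξ' := by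
  obtain ⟨ξ', hξ', h0', hn'⟩ := rootR hG F F' hF' hrel h1 h2 hs hmono hinf
  obtain ⟨ξ, hξ, h0, hn⟩ := rootR (G := Tneg (Tswap G)) hG.swap.neg
    (fun x => - F' (-x)) (fun x => - F (-x)) (by fun_prop) (y := -y') (y' := -y)
    (TRel_neg (TRel_swap.2 hrel)) (by simpa using h2) (by simpa using h1)
    (by
      intro p hp
      have := hs _ (mem_Tswap.1 (mem_Tneg.1 hp))
      dsimp at this
      rw [Left.sign_neg, Left.sign_neg, this])
    (by
      intro z hz hz'
      have := hmono' (-z) (by linarith) (by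
        rintro p hp ⟨a, b⟩
        apply hz' (-p.2, -p.1)
        · rw [mem_Tneg, mem_Tswap]; simpa using hp
        · constructor <;> dsimp <;> linarith)
      simpa using this)
    (by
      intro h
      obtain ⟨z, hz, hz0⟩ := hinf' (by
        intro p hp a
        apply h (-p.2, -p.1)
        · rw [mem_Tneg, mem_Tswap]; simpa using hp
        · dsimp; linarith)
      exact ⟨-z, by linarith, by simpa using hz0⟩)
  refine ⟨-ξ, by linarith, ξ', hξ', by simpa using h0, h0', ?_⟩
  intro p hp
  have a1 := hn' p hp
  have a2 : ¬ (-ξ ≤ p.1 ∧ p.1 < y) := by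
    rintro ⟨a, b⟩
    apply hn (-p.2, -p.1)
    · rw [mem_Tneg, mem_Tswap]; simpa using hp
    · constructor <;> dsimp <;> linarith
  have b1 := hrel p hp
  have b2 := hy p hp
  have b3 : p.2 ≠ y' := fun h => b2 ((hrel.eq_iff hp).2 h)
  have hξy : -ξ ≤ y := by linarith
  rcases lt_or_gt_of_ne b2 with c | c
  · have c' := b1.1.1 c
    have d : p.1 < -ξ := by
      by_contra h
      exact a2 ⟨not_lt.1 h, c⟩
    constructor
    · exact ⟨fun _ => by linarith, fun _ => d⟩
    · exact ⟨fun h => by linarith, fun h => by linarith⟩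
  · have c' := b1.2.1 c
    have d : ξ' < p.2 := by
      by_contra h
      exact a1 ⟨c', not_lt.1 h⟩
    constructor
    · exact ⟨fun h => by linarith, fun h => by linarith⟩
    · exact ⟨fun _ => d, fun _ => by linarith⟩

lemma poly_monoR (f : Polynomial ℝ) {y z : ℝ} (hyz : y < z) (h0 : 0 < f.derivative.eval y)
    (h : ∀ w, y < w → w < z → f.derivative.eval w ≠ 0) : f.eval y < f.eval z := by
  have hpos : ∀ w, y < w → w < z → 0 < f.derivative.eval w := by
    intro w h1 h2
    by_contra hn
    obtain ⟨c, hc, hc0⟩ := intermediate_value_Icc' h1.le f.derivative.continuous.continuousOn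
      (show (0:ℝ) ∈ Icc (f.derivative.eval w) (f.derivative.eval y) from ⟨not_lt.1 hn, h0.le⟩)
    have hcy : c ≠ y := by rintro rfl; linarith
    exact h c (lt_of_le_of_ne hc.1 hcy.symm) (lt_of_le_of_lt hc.2 h2) hc0
  have := strictMonoOn_of_deriv_pos (convex_Icc y z) (f := fun x => f.eval x)
    f.continuous.continuousOn (by
      intro x hx
      rw [interior_Icc] at hx
      rw [Polynomial.deriv]
      exact hpos x hx.1 hx.2)
  exact this (left_mem_Icc.2 hyz.le) (right_mem_Icc.2 hyz.le) hyz

lemma poly_infR (f : Polynomial ℝ) {y : ℝ} (h0 : 0 < f.derivative.eval y)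
    (h : ∀ w, y < w → f.derivative.eval w ≠ 0) : ∃ z > y, 0 < f.eval z := by
  have hdeg : 0 < f.degree := by
    rw [← Polynomial.natDegree_pos_iff_degree_pos]
    by_contra hn
    have : f.natDegree = 0 := by omega
    rw [Polynomial.eq_C_of_natDegree_eq_zero this] at h0
    simp at h0
  rcases le_total 0 f.leadingCoeff with hl | hl
  · have := f.tendsto_atTop_of_leadingCoeff_nonneg hdeg hl
    obtain ⟨z, hz1, hz2⟩ := ((this.eventually_gt_atTop 0).and (Filter.eventually_gt_atTop y)).exists
    exact ⟨z, hz2, hz1⟩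
  · have := f.tendsto_atBot_of_leadingCoeff_nonpos hdeg hl
    obtain ⟨z, hz1, hz2⟩ := ((this.eventually_lt_atBot (f.eval y)).and
      (Filter.eventually_gt_atTop y)).exists
    have := poly_monoR f hz2 h0 (fun w h1 _ => h w h1)
    linarith

lemma refl_der (f : Polynomial ℝ) (y : ℝ) :
    (-(f.comp (-Polynomial.X))).derivative.eval y = f.derivative.eval (-y) := by
  simp [Polynomial.derivative_comp]

lemma poly_monoL (f : Polynomial ℝ) {y z : ℝ} (hyz : z < y) (h0 : 0 < f.derivative.eval y)
    (h : ∀ w, z < w → w < y → f.derivative.eval w ≠ 0) : f.eval z < f.eval y := by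
  have := poly_monoR (-(f.comp (-Polynomial.X))) (y := -y) (z := -z) (by linarith)
    (by rw [refl_der]; simpa using h0)
    (by intro w h1 h2; rw [refl_der]; exact h _ (by linarith) (by linarith))
  simpa using this

lemma poly_infL (f : Polynomial ℝ) {y : ℝ} (h0 : 0 < f.derivative.eval y)
    (h : ∀ w, w < y → f.derivative.eval w ≠ 0) : ∃ z < y, f.eval z < 0 := by
  obtain ⟨z, hz, hz0⟩ := poly_infR (-(f.comp (-Polynomial.X))) (y := -y)
    (by rw [refl_der]; simpa using h0)
    (by intro w h1; rw [refl_der]; exact h _ (by linarith))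
  exact ⟨-z, by linarith, by simpa using hz0⟩

structure TStp (G : Finset (ℝ × ℝ)) (f f' : Polynomial ℝ) : Prop where
  pi : TPI G
  hd : ∀ y y', TRel G y y' → SignType.sign (f.derivative.eval y) =
    SignType.sign (f'.derivative.eval y')
  nz : ∀ y, f.derivative.eval y = 0 → ∃ p ∈ G, p.1 = y
  nz' : ∀ y, f'.derivative.eval y = 0 → ∃ p ∈ G, p.2 = y
  hs : ∀ p ∈ G, SignType.sign (f.eval p.1) = SignType.sign (f'.eval p.2)

lemma TStp.swap {G : Finset (ℝ × ℝ)} {f f' : Polynomial ℝ} (h : TStp G f f') :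
    TStp (Tswap G) f' f where
  pi := h.pi.swap
  hd := fun y y' hr => (h.hd y' y (TRel_swap.1 hr)).symm
  nz := fun y hy => by
    obtain ⟨p, hp, e⟩ := h.nz' y hy
    exact ⟨(p.2, p.1), mem_Tswap.2 hp, e⟩
  nz' := fun y hy => by
    obtain ⟨p, hp, e⟩ := h.nz y hy
    exact ⟨(p.2, p.1), mem_Tswap.2 hp, e⟩
  hs := fun p hp => (h.hs _ (mem_Tswap.1 hp)).symm

lemma TStp.neg {G : Finset (ℝ × ℝ)} {f f' : Polynomial ℝ} (h : TStp G f f') :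
    TStp G (-f) (-f') where
  pi := h.pi
  hd := fun y y' hr => by
    simp only [Polynomial.derivative_neg, Polynomial.eval_neg, Left.sign_neg, h.hd y y' hr]
  nz := fun y hy => h.nz y (by simpa using hy)
  nz' := fun y hy => h.nz' y (by simpa using hy)
  hs := fun p hp => by simp only [Polynomial.eval_neg, Left.sign_neg, h.hs p hp]

lemma TStp.core {G : Finset (ℝ × ℝ)} {f f' : Polynomial ℝ} (h : TStp G f f') {y y' : ℝ}
    (hrel : TRel G y y') (hy : ∀ p ∈ G, p.1 ≠ y) (hpos : 0 < f.derivative.eval y)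
    (h1 : 0 ≤ f.eval y) (h2 : f'.eval y' ≤ 0) :
    ∃ ξ ≤ y, ∃ ξ' ≥ y', f.eval ξ = 0 ∧ f'.eval ξ' = 0 ∧ TRel G ξ ξ' := by
  have hpos' : 0 < f'.derivative.eval y' := by
    have := h.hd y y' hrel
    rw [sign_pos hpos] at this
    exact sign_eq_one_iff.1 this.symm
  refine rootBoth h.pi (fun x => f.eval x) (fun x => f'.eval x) f.continuous f'.continuous hrel hy
    h1 h2 h.hs ?_ ?_ ?_ ?_
  · intro z hz hn
    refine poly_monoR f hz hpos (fun w w1 w2 w0 => ?_)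
    obtain ⟨p, hp, rfl⟩ := h.nz w w0
    exact hn p hp ⟨w1, w2⟩
  · intro hn
    refine poly_infR f' hpos' (fun w w1 w0 => ?_)
    obtain ⟨p, hp, rfl⟩ := h.nz' w w0
    exact hn p hp w1
  · intro z hz hn
    refine poly_monoL f' hz hpos' (fun w w1 w2 w0 => ?_)
    obtain ⟨p, hp, rfl⟩ := h.nz' w w0
    exact hn p hp ⟨w1, w2⟩
  · intro hn
    refine poly_infL f hpos (fun w w1 w0 => ?_)
    obtain ⟨p, hp, rfl⟩ := h.nz w w0
    exact hn p hp w1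

lemma TStp.roots_lt {G : Finset (ℝ × ℝ)} {f f' : Polynomial ℝ} (h : TStp G f f') {a b a' b' : ℝ}
    (ha : f.eval a = 0) (hb : f.eval b = 0) (hra : TRel G a a') (hrb : TRel G b b')
    (hab : a < b) : a' < b' := by
  obtain ⟨c, hc, hc0⟩ := exists_deriv_eq_zero (f := fun x => f.eval x) hab
    f.continuous.continuousOn (by rw [ha, hb])
  rw [Polynomial.deriv] at hc0
  obtain ⟨p, hp, rfl⟩ := h.nz c hc0
  have h1 := (hra p hp).2.1 hc.1
  have h2 := (hrb p hp).1.1 hc.2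
  linarith

lemma TStp.extend {G : Finset (ℝ × ℝ)} {f f' : Polynomial ℝ} (h : TStp G f f') :
    ∃ G2, G ⊆ G2 ∧ TPI G2 ∧ ∀ y y', TRel G2 y y' →
      SignType.sign (f.eval y) = SignType.sign (f'.eval y') := by
  classical
  have hf0 : f ≠ 0 := by
    rintro rfl
    have : ∀ y : ℝ, y ∈ (G.image Prod.fst) := by
      intro y
      obtain ⟨p, hp, e⟩ := h.nz y (by simp)
      exact Finset.mem_image.2 ⟨p, hp, e⟩
    exact Set.infinite_univ ((Finset.finite_toSet _).subset (fun y _ => Finset.mem_coe.2 (this y)))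
  have hf0' : f' ≠ 0 := by
    rintro rfl
    have : ∀ y : ℝ, y ∈ (G.image Prod.snd) := by
      intro y
      obtain ⟨p, hp, e⟩ := h.nz' y (by simp)
      exact Finset.mem_image.2 ⟨p, hp, e⟩
    exact Set.infinite_univ ((Finset.finite_toSet _).subset (fun y _ => Finset.mem_coe.2 (this y)))
  let N := (f.roots.toFinset ×ˢ f'.roots.toFinset).filter (fun p => TRel G p.1 p.2)
  have memN : ∀ p, p ∈ N ↔ (f.eval p.1 = 0 ∧ f'.eval p.2 = 0) ∧ TRel G p.1 p.2 := by
    intro p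
    simp [N, hf0, hf0', Polynomial.IsRoot]
  have hNN : ∀ p ∈ N, ∀ q ∈ N, (p.1 < q.1 ↔ p.2 < q.2) := by
    intro p hp q hq
    rw [memN] at hp hq
    constructor
    · exact h.roots_lt hp.1.1 hq.1.1 hp.2 hq.2
    · exact h.swap.roots_lt hp.1.2 hq.1.2 (TRel_swap.2 hp.2) (TRel_swap.2 hq.2)
  refine ⟨G ∪ N, Finset.subset_union_left, ?_, ?_⟩
  · intro p hp q hq
    rw [Finset.mem_union] at hp hq
    rcases hp with hp | hp <;> rcases hq with hq | hq
    · exact h.pi p hp q hq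
    · have := ((memN q).1 hq).2 p hp
      exact ⟨this.2, this.1⟩
    · exact ((memN p).1 hp).2 q hq
    · exact ⟨hNN q hq p hp, hNN p hp q hq⟩
  · intro y y' hr
    have hrG : TRel G y y' := hr.mono Finset.subset_union_left
    have hrN : TRel N y y' := hr.mono Finset.subset_union_right
    by_cases hyG : ∃ p ∈ G, p.1 = y
    · obtain ⟨p, hp, e⟩ := hyG
      have e' := (hrG.eq_iff hp).1 e
      rw [← e, ← e']
      exact h.hs p hp
    · push Not at hyG
      have hyG' : ∀ p ∈ Tswap G, p.1 ≠ y' := by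
        intro p hp e
        exact hyG _ (mem_Tswap.1 hp) ((hrG.eq_iff (mem_Tswap.1 hp)).2 e)
      have hne : f.derivative.eval y ≠ 0 := by
        intro h0
        obtain ⟨p, hp, e⟩ := h.nz y h0
        exact hyG p hp e
      have hdd := h.hd y y' hrG
      have key : ∀ ξ ξ', f.eval ξ = 0 → f'.eval ξ' = 0 → TRel G ξ ξ' →
          ((ξ ≤ y ∧ y' ≤ ξ') ∨ (y ≤ ξ ∧ ξ' ≤ y')) → f.eval y = 0 ∧ f'.eval y' = 0 := by
        intro ξ ξ' h1 h2 h3 h4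
        have hm : (ξ, ξ') ∈ N := (memN _).2 ⟨⟨h1, h2⟩, h3⟩
        have hc := hrN _ hm
        have he := hrN.eq_iff hm
        dsimp at hc he
        have : ξ = y := by
          rcases h4 with ⟨a, b⟩ | ⟨a, b⟩
          · rcases a.lt_or_eq with a | a
            · have := hc.1.1 a; linarith
            · exact a
          · rcases a.lt_or_eq with a | a
            · have := hc.2.1 a; linarith
            · exact a.symm
        have e' := he.1 this
        rw [← this, ← e']
        exact ⟨h1, h2⟩
      have fin : f.eval y = 0 ∧ f'.eval y' = 0 →
          SignType.sign (f.eval y) = SignType.sign (f'.eval y') := by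
        rintro ⟨a, b⟩; rw [a, b]
      have tri : SignType.sign (f.eval y) = SignType.sign (f'.eval y') ∨
          (0 ≤ f.eval y ∧ f'.eval y' ≤ 0) ∨ (f.eval y ≤ 0 ∧ 0 ≤ f'.eval y') := by
        rcases lt_trichotomy (f.eval y) 0 with a | a | a
        · rcases lt_or_ge (f'.eval y') 0 with b | b
          · left; rw [sign_neg a, sign_neg b]
          · right; right; exact ⟨a.le, b⟩
        · rcases le_total (f'.eval y') 0 with b | b
          · right; left; exact ⟨a.ge, b⟩
          · right; right; exact ⟨a.le, b⟩
        · rcases lt_or_ge 0 (f'.eval y') with b | b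
          · left; rw [sign_pos a, sign_pos b]
          · right; left; exact ⟨a.le, b⟩
      rcases tri with tri | ⟨a, b⟩ | ⟨a, b⟩
      · exact tri
      · rcases lt_or_gt_of_ne hne with hneg | hpos
        · have hneg' : f'.derivative.eval y' < 0 := by
            rw [sign_neg hneg] at hdd
            exact sign_eq_neg_one_iff.1 hdd.symm
          obtain ⟨ξ, c1, ξ', c2, c3, c4, c5⟩ := h.swap.neg.core (TRel_swap.2 hrG) hyG'
            (by simpa using hneg') (by simpa using b) (by simpa using a)
          exact fin (key ξ' ξ (by simpa using c4) (by simpa using c3) (TRel_swap.1 c5)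
            (Or.inr ⟨c2, c1⟩))
        · obtain ⟨ξ, c1, ξ', c2, c3, c4, c5⟩ := h.core hrG hyG hpos a b
          exact fin (key ξ ξ' c3 c4 c5 (Or.inl ⟨c1, c2⟩))
      · rcases lt_or_gt_of_ne hne with hneg | hpos
        · obtain ⟨ξ, c1, ξ', c2, c3, c4, c5⟩ := h.neg.core hrG hyG (by simpa using hneg)
            (by simpa using a) (by simpa using b)
          exact fin (key ξ ξ' (by simpa using c3) (by simpa using c4) c5 (Or.inl ⟨c1, c2⟩))
        · have hpos' : 0 < f'.derivative.eval y' := by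
            rw [sign_pos hpos] at hdd
            exact sign_eq_one_iff.1 hdd.symm
          obtain ⟨ξ, c1, ξ', c2, c3, c4, c5⟩ := h.swap.core (TRel_swap.2 hrG) hyG' hpos' b a
          exact fin (key ξ' ξ c4 c3 (TRel_swap.1 c5) (Or.inr ⟨c2, c1⟩))

section TarskiAlg
set_option linter.unusedSectionVars false
variable {A : Type*} [CommRing A] [IsDomain A]

lemma pdiv_aux (g : Polynomial A) (hg : g ≠ 0) : ∀ (m : ℕ) (f : Polynomial A), f.natDegree < m →
    ∃ (N : ℕ) (q r : Polynomial A), Polynomial.C (g.leadingCoeff ^ N) * f = q * g + r ∧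
      r.degree < g.degree := by
  intro m
  induction m with
  | zero => intro f h; omega
  | succ m ih =>
    intro f hf
    by_cases hlt : f.degree < g.degree
    · exact ⟨0, 0, f, by simp, hlt⟩
    have hle : g.degree ≤ f.degree := not_lt.1 hlt
    have hf0 : f ≠ 0 := by
      rintro rfl
      simp at hle
      exact hg hle
    have hnat : g.natDegree ≤ f.natDegree := Polynomial.natDegree_le_natDegree hle
    have hlg : g.leadingCoeff ≠ 0 := Polynomial.leadingCoeff_ne_zero.2 hg
    have hlf : f.leadingCoeff ≠ 0 := Polynomial.leadingCoeff_ne_zero.2 hf0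
    set u := Polynomial.C g.leadingCoeff * f with hu
    set v := Polynomial.C f.leadingCoeff * Polynomial.X ^ (f.natDegree - g.natDegree) * g with hv
    have hu0 : u ≠ 0 := mul_ne_zero (Polynomial.C_ne_zero.2 hlg) hf0
    have hv0 : v ≠ 0 := mul_ne_zero (mul_ne_zero (Polynomial.C_ne_zero.2 hlf)
      (pow_ne_zero _ Polynomial.X_ne_zero)) hg
    have hun : u.natDegree = f.natDegree := by
      rw [hu, Polynomial.natDegree_C_mul hlg]
    have hvn : v.natDegree = f.natDegree := by
      rw [hv, Polynomial.natDegree_mul (mul_ne_zero (Polynomial.C_ne_zero.2 hlf)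
      (pow_ne_zero _ Polynomial.X_ne_zero)) hg, Polynomial.natDegree_C_mul hlf,
        Polynomial.natDegree_X_pow]
      omega
    have hdeg : u.degree = v.degree := by
      rw [Polynomial.degree_eq_natDegree hu0, Polynomial.degree_eq_natDegree hv0, hun, hvn]
    have hlc : u.leadingCoeff = v.leadingCoeff := by
      rw [hu, hv]
      rw [Polynomial.leadingCoeff_mul, Polynomial.leadingCoeff_mul, Polynomial.leadingCoeff_mul,
        Polynomial.leadingCoeff_C, Polynomial.leadingCoeff_C, Polynomial.leadingCoeff_X_pow, mul_one,
        mul_comm]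
    by_cases hz : u - v = 0
    · refine ⟨1, Polynomial.C f.leadingCoeff * Polynomial.X ^ (f.natDegree - g.natDegree), 0, ?_, ?_⟩
      · rw [pow_one, ← hu, ← hv, add_zero]; exact sub_eq_zero.1 hz
      · rw [Polynomial.degree_zero]; exact bot_lt_iff_ne_bot.2 (fun h => hg (Polynomial.degree_eq_bot.1 h))
    have hlt2 := Polynomial.degree_sub_lt_left hdeg hu0 hlc
    have hlt3 : (u - v).natDegree < m ∨ f.natDegree = 0 := by
      have : (u-v).natDegree < u.natDegree := Polynomial.natDegree_lt_natDegree hz hlt2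
      left; omega
    rcases hlt3 with hlt3 | h0
    · obtain ⟨N, q, r, h1, h2⟩ := ih (u - v) hlt3
      refine ⟨N + 1, q + Polynomial.C (g.leadingCoeff ^ N) * (Polynomial.C f.leadingCoeff * Polynomial.X ^ (f.natDegree - g.natDegree)), r, ?_, h2⟩
      have : Polynomial.C (g.leadingCoeff ^ (N+1)) * f
          = Polynomial.C (g.leadingCoeff ^ N) * (u - v) + Polynomial.C (g.leadingCoeff ^ N) * v := by
        rw [hu, pow_succ, Polynomial.C_mul]; ring
      rw [this, h1, hv]; ring
    · exfalso
      have : (u-v).natDegree < u.natDegree := Polynomial.natDegree_lt_natDegree hz hlt2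
      omega

lemma pdiv (f g : Polynomial A) :
    ∃ (N : ℕ) (q r : Polynomial A), (g ≠ 0 → Polynomial.C (g.leadingCoeff ^ N) * f = q * g + r) ∧
      r.natDegree ≤ g.natDegree - 1 := by
  by_cases hg : g = 0
  · exact ⟨0, 0, 0, fun h => (h hg).elim, by simp⟩
  · obtain ⟨N, q, r, h1, h2⟩ := pdiv_aux g hg _ f (Nat.lt_succ_self _)
    refine ⟨N, q, r, fun _ => h1, ?_⟩
    by_cases hr : r = 0
    · simp [hr]
    · have := Polynomial.natDegree_lt_natDegree hr h2
      omega

lemma map_eq_eraseLead (g : Polynomial A) (e : A →+* ℝ) (h : e g.leadingCoeff = 0) :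
    g.map e = g.eraseLead.map e := by
  conv_lhs => rw [← Polynomial.eraseLead_add_monomial_natDegree_leadingCoeff g]
  rw [Polynomial.map_add, Polynomial.map_monomial, h, map_zero, add_zero]

lemma trunc_ex : ∀ (m : ℕ) (g : Polynomial A), g.support.card < m →
    ∃ T : Finset (Polynomial A), g ∈ T ∧ (∀ t ∈ T, t = g ∨ t.natDegree ≤ g.natDegree - 1) ∧
      ∀ e e' : A →+* ℝ, (∀ t ∈ T, (e t.leadingCoeff = 0 ↔ e' t.leadingCoeff = 0)) →
        (g.map e = 0 ∧ g.map e' = 0) ∨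
        ∃ t ∈ T, e t.leadingCoeff ≠ 0 ∧ e' t.leadingCoeff ≠ 0 ∧ t.map e = g.map e ∧
          t.map e' = g.map e' := by
  classical
  intro m
  induction m with
  | zero => intro g h; omega
  | succ m ih =>
    intro g hg
    by_cases g0 : g = 0
    · refine ⟨{g}, by simp, by simp, ?_⟩
      intro e e' _
      left; simp [g0]
    obtain ⟨T, h1, h2, h3⟩ := ih g.eraseLead (by
      have := Polynomial.eraseLead_support_card_lt g0; omega)
    refine ⟨insert g T, by simp, ?_, ?_⟩
    · intro t ht
      rw [Finset.mem_insert] at ht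
      rcases ht with ht | ht
      · left; exact ht
      · right
        have hh := Polynomial.eraseLead_natDegree_le g
        rcases h2 t ht with e | e
        · rw [e]; exact hh
        · omega
    · intro e e' hh
      have hgg := hh g (by simp)
      by_cases hz : e g.leadingCoeff = 0
      · have hz' := hgg.1 hz
        rw [map_eq_eraseLead g e hz, map_eq_eraseLead g e' hz']
        rcases h3 e e' (fun t ht => hh t (Finset.mem_insert_of_mem ht)) with a | ⟨t, ht, a⟩
        · left; exact a
        · right; exact ⟨t, Finset.mem_insert_of_mem ht, a⟩
      · right
        exact ⟨g, by simp, hz, fun h => hz (hgg.2 h), rfl, rfl⟩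

def TMatch (L : Finset (Polynomial A)) (e e' : A →+* ℝ) (G : Finset (ℝ × ℝ)) : Prop :=
  TPI G ∧ ∀ y y', TRel G y y' → ∀ q ∈ L,
    SignType.sign ((q.map e).eval y) = SignType.sign ((q.map e').eval y')

def TGood (L : Finset (Polynomial A)) : Prop :=
  ∃ D : Finset A, ∀ e e' : A →+* ℝ, (∀ d ∈ D, SignType.sign (e d) = SignType.sign (e' d)) →
    ∃ G, TMatch L e e' G

lemma root_mem {G : Finset (ℝ × ℝ)} (hG : TPI G) {g g' : Polynomial ℝ} (hg : g ≠ 0)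
    (hm : ∀ y y', TRel G y y' → SignType.sign (g.eval y) = SignType.sign (g'.eval y'))
    {a : ℝ} (ha : g.eval a = 0) : ∃ p ∈ G, p.1 = a := by
  by_contra hn
  push Not at hn
  obtain ⟨a', ha'⟩ := hG.across a
  have hev : ∀ᶠ z in nhds a, TRel G z a' := by
    unfold TRel
    rw [Filter.eventually_all_finset]
    intro p hp
    have hrel := ha' p hp
    rcases lt_or_gt_of_ne (hn p hp) with h | h
    · filter_upwards [lt_mem_nhds h] with z hz
      have := hrel.1.1 h
      exact ⟨⟨fun _ => this, fun _ => hz⟩, ⟨fun h => by linarith, fun h => by linarith⟩⟩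
    · filter_upwards [gt_mem_nhds h] with z hz
      have := hrel.2.1 h
      exact ⟨⟨fun h => by linarith, fun h => by linarith⟩, ⟨fun _ => this, fun _ => hz⟩⟩
  have h0 : SignType.sign (g'.eval a') = 0 := by rw [← hm a a' ha', ha, sign_zero]
  apply hg
  apply Polynomial.eq_zero_of_infinite_isRoot
  refine (infinite_of_mem_nhds a hev).mono ?_
  intro z hz
  have := hm z a' hz
  rw [h0] at this
  exact sign_eq_zero_iff.1 this

lemma sign_ne_root (g : Polynomial ℝ) {a b : ℝ}
    (h : SignType.sign (g.eval a) ≠ SignType.sign (g.eval b)) :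
    ∃ c ∈ uIcc a b, g.eval c = 0 := by
  have h0 : (0:ℝ) ∈ uIcc (g.eval a) (g.eval b) := by
    rw [mem_uIcc]
    by_contra hn
    push Not at hn
    apply h
    rcases lt_trichotomy (g.eval a) 0 with x | x | x
    · rw [sign_neg x, sign_neg (hn.1 x.le)]
    · have h1 := hn.1 x.le
      have h2 : ¬ (g.eval b ≤ 0) := fun h3 => by have := hn.2 h3; linarith
      exact absurd h1.le h2
    · have : 0 < g.eval b := by
        by_contra h3
        have := hn.2 (not_lt.1 h3); linarith
      rw [sign_pos x, sign_pos this]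
  obtain ⟨c, hc, hc0⟩ := intermediate_value_uIcc (f := fun x => g.eval x)
    g.continuous.continuousOn h0
  exact ⟨c, hc, hc0⟩

end TarskiAlg

section TarskiAlg2
set_option linter.unusedSectionVars false
variable {A : Type*} [CommRing A] [IsDomain A]

lemma tarski_step [DecidableEq (Polynomial A)] {L0 H L1 : Finset (Polynomial A)} {f : Polynomial A} {e e' : A →+* ℝ}
    (hH1 : H ⊆ L1)
    (hK : ∀ g ∈ insert f.derivative L0, (g.map e = 0 ∧ g.map e' = 0) ∨
        ∃ t ∈ H, e t.leadingCoeff ≠ 0 ∧ e' t.leadingCoeff ≠ 0 ∧ t.map e = g.map e ∧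
          t.map e' = g.map e')
    (hrem : ∀ g ∈ H, g ≠ 0 → ∃ N : ℕ, ∃ q, ∃ r ∈ L1,
      Polynomial.C (g.leadingCoeff ^ N) * f = q * g + r ∧ Even N)
    (hfd : f.derivative.map e ≠ 0)
    {G1 : Finset (ℝ × ℝ)} (hm : TMatch L1 e e' G1) : ∃ G, TMatch (insert f L0) e e' G := by
  classical
  obtain ⟨hG1, hm⟩ := hm
  have hnz : ∀ (t : Polynomial A) (i : A →+* ℝ), i t.leadingCoeff ≠ 0 → t.map i ≠ 0 := by
    intro t i h h0
    apply h
    have := congrArg (fun p => Polynomial.coeff p t.natDegree) h0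
    simpa [Polynomial.coeff_map] using this
  set P : Polynomial A → Prop := fun g => g ∈ H ∧ e g.leadingCoeff ≠ 0 ∧ e' g.leadingCoeff ≠ 0
    with hP
  set G := G1.filter (fun p => ∃ g, P g ∧ (g.map e).eval p.1 = 0) with hGdef
  have hGsub : G ⊆ G1 := Finset.filter_subset _ _
  have hG : TPI G := fun p hp => (hG1 p (hGsub hp)).mono hGsub
  have rt : ∀ g, P g → ∀ a, (g.map e).eval a = 0 → ∃ p ∈ G, p.1 = a := by
    intro g hg a ha
    obtain ⟨p, hp, hpa⟩ := root_mem hG1 (hnz g e hg.2.1)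
      (fun y y' h => hm y y' h g (hH1 hg.1)) ha
    exact ⟨p, Finset.mem_filter.2 ⟨hp, g, hg, by rw [hpa, ha]⟩, hpa⟩
  have rt' : ∀ g, P g → ∀ a, (g.map e').eval a = 0 → ∃ p ∈ G, p.2 = a := by
    intro g hg a ha
    obtain ⟨p, hp, hpa⟩ := root_mem (g' := g.map e) hG1.swap (hnz g e' hg.2.2)
      (fun y y' h => (hm y' y (TRel_swap.1 h) g (hH1 hg.1)).symm) ha
    have hp' := mem_Tswap.1 hp
    refine ⟨_, Finset.mem_filter.2 ⟨hp', g, hg, ?_⟩, hpa⟩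
    have := hm _ _ (hG1 _ hp') g (hH1 hg.1)
    dsimp at this ⊢
    rw [hpa, ha, sign_zero] at this
    exact sign_eq_zero_iff.1 this
  have mP : ∀ g, P g → ∀ y y', TRel G y y' →
      SignType.sign ((g.map e).eval y) = SignType.sign ((g.map e').eval y') := by
    intro g hg y y' hr
    obtain ⟨z, hz⟩ := hG1.across y
    rw [hm y z hz g (hH1 hg.1)]
    by_contra hne
    obtain ⟨c, hc, hc0⟩ := sign_ne_root _ hne
    obtain ⟨p, hp, rfl⟩ := rt' g hg c hc0
    have a1 := hr p hp
    have a2 := hz p (hGsub hp)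
    have e1 := hr.eq_iff hp
    have e2 := hz.eq_iff (hGsub hp)
    have : z = y' := by
      rw [mem_uIcc] at hc
      rcases lt_trichotomy p.1 y with b | b | b
      · have := a1.1.1 b
        have := a2.1.1 b
        rcases hc with hc | hc <;> linarith [hc.1, hc.2]
      · rw [← e1.1 b, ← e2.1 b]
      · have := a1.2.1 b
        have := a2.2.1 b
        rcases hc with hc | hc <;> linarith [hc.1, hc.2]
    exact hne (by rw [this])
  have mK : ∀ g ∈ insert f.derivative L0, ∀ y y', TRel G y y' →
      SignType.sign ((g.map e).eval y) = SignType.sign ((g.map e').eval y') := by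
    intro g hg y y' hr
    rcases hK g hg with ⟨h1, h2⟩ | ⟨t, ht, h1, h2, h3, h4⟩
    · rw [h1, h2]; simp
    · rw [← h3, ← h4]
      exact mP t ⟨ht, h1, h2⟩ y y' hr
  obtain ⟨td, htd, d1, d2, d3, d4⟩ : ∃ t ∈ H, e t.leadingCoeff ≠ 0 ∧ e' t.leadingCoeff ≠ 0 ∧
      t.map e = f.derivative.map e ∧ t.map e' = f.derivative.map e' := by
    rcases hK f.derivative (Finset.mem_insert_self _ _) with h | h
    · exact absurd h.1 hfd
    · exact h
  have stp : TStp G (f.map e) (f.map e') := by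
    refine ⟨hG, ?_, ?_, ?_, ?_⟩
    · intro y y' hr
      rw [Polynomial.derivative_map, Polynomial.derivative_map]
      exact mK _ (Finset.mem_insert_self _ _) y y' hr
    · intro y hy
      rw [Polynomial.derivative_map, ← d3] at hy
      exact rt td ⟨htd, d1, d2⟩ y hy
    · intro y hy
      rw [Polynomial.derivative_map, ← d4] at hy
      exact rt' td ⟨htd, d1, d2⟩ y hy
    · intro p hp
      obtain ⟨hp1, g, hg, hg0⟩ := Finset.mem_filter.1 hp
      have hg0' : (g.map e').eval p.2 = 0 := by
        have := hm _ _ (hG1 p hp1) g (hH1 hg.1)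
        rw [hg0, sign_zero] at this
        exact sign_eq_zero_iff.1 this.symm
      have hgne : g ≠ 0 := by
        rintro rfl
        exact hg.2.1 (by simp)
      obtain ⟨N, q, r, hr, hdiv, hN⟩ := hrem g hg.1 hgne
      have aux : ∀ (i : A →+* ℝ) (x : ℝ), i g.leadingCoeff ≠ 0 → (g.map i).eval x = 0 →
          SignType.sign ((f.map i).eval x) = SignType.sign ((r.map i).eval x) := by
        intro i x hi hx
        have := congrArg (fun p => (Polynomial.map i p).eval x) hdiv
        simp only [Polynomial.map_mul, Polynomial.map_add, Polynomial.eval_mul,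
          Polynomial.eval_add, hx, mul_zero, zero_add, Polynomial.map_C, Polynomial.eval_C] at this
        rw [map_pow] at this
        rw [← this, sign_mul, sign_pos (hN.pow_pos hi), one_mul]
      rw [aux e p.1 hg.2.1 hg0, aux e' p.2 hg.2.2 hg0']
      exact hm _ _ (hG1 p hp1) r hr
  obtain ⟨G2, hsub, hpi, hf⟩ := stp.extend
  refine ⟨G2, hpi, fun y y' hr q hq => ?_⟩
  rcases Finset.mem_insert.1 hq with rfl | hq
  · exact hf y y' hr
  · exact mK q (Finset.mem_insert_of_mem hq) y y' (hr.mono hsub)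

lemma TMatch.mono {L L' : Finset (Polynomial A)} (h : L ⊆ L') {e e' : A →+* ℝ}
    {G : Finset (ℝ × ℝ)} (hm : TMatch L' e e' G) : TMatch L e e' G :=
  ⟨hm.1, fun y y' hr q hq => hm.2 y y' hr q (h hq)⟩

lemma tarski_ind : ∀ (d k : ℕ) (L : Finset (Polynomial A)), (∀ q ∈ L, q.natDegree ≤ d) →
    (L.filter (fun q => q.natDegree = d)).card ≤ k → TGood L := by
  classical
  intro d
  induction d with
  | zero =>
    intro k L hL _
    refine ⟨L.image (fun q => q.coeff 0), fun e e' hD => ⟨∅, fun p hp => by simp at hp, ?_⟩⟩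
    intro y y' _ q hq
    have h0 : q = Polynomial.C (q.coeff 0) :=
      Polynomial.eq_C_of_natDegree_eq_zero (Nat.le_zero.1 (hL q hq))
    rw [h0]
    simp only [Polynomial.map_C, Polynomial.eval_C]
    exact hD _ (Finset.mem_image_of_mem _ hq)
  | succ d ihd =>
    intro k
    induction k with
    | zero =>
      intro L hL hc
      refine ihd _ L ?_ le_rfl
      intro q hq
      have h1 := hL q hq
      have h2 : q.natDegree ≠ d + 1 := by
        intro h
        have : q ∈ L.filter (fun q => q.natDegree = d + 1) := Finset.mem_filter.2 ⟨hq, h⟩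
        rw [Finset.card_eq_zero.1 (Nat.le_zero.1 hc)] at this
        simp at this
      omega
    | succ k ihk =>
      intro L hL hc
      by_cases hex : ∃ f ∈ L, f.natDegree = d + 1
      swap
      · push Not at hex
        refine ihd _ L ?_ le_rfl
        intro q hq
        have h1 := hL q hq
        have h2 := hex q hq
        omega
      obtain ⟨f, hf, hfd⟩ := hex
      set L0 := L.erase f with hL0
      have hins : insert f L0 = L := Finset.insert_erase hf
      have hcard0 : (L0.filter (fun q => q.natDegree = d + 1)).card ≤ k := by
        have : L0.filter (fun q => q.natDegree = d + 1)
            = (L.filter (fun q => q.natDegree = d + 1)).erase f := by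
          ext q; simp only [hL0, Finset.mem_filter, Finset.mem_erase]; tauto
        rw [this, Finset.card_erase_of_mem (Finset.mem_filter.2 ⟨hf, hfd⟩)]
        omega
      have hL0d : ∀ q ∈ L0, q.natDegree ≤ d + 1 := fun q hq => hL q (Finset.mem_of_mem_erase hq)
      -- branch where the leading coefficient vanishes
      obtain ⟨D0, hD0⟩ := ihk (insert f.eraseLead L0) (by
        intro q hq
        rcases Finset.mem_insert.1 hq with rfl | hq
        · have := Polynomial.eraseLead_natDegree_le f; omega
        · exact hL0d q hq) (by
        refine le_trans (Finset.card_le_card ?_) hcard0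
        intro q hq
        rw [Finset.mem_filter, Finset.mem_insert] at hq
        obtain ⟨rfl | hq, hqd⟩ := hq
        · have := Polynomial.eraseLead_natDegree_le f; omega
        · exact Finset.mem_filter.2 ⟨hq, hqd⟩)
      -- truncations
      choose T hT1 hT2 hT3 using fun g : Polynomial A => trunc_ex _ g (Nat.lt_succ_self _)
      choose N Q R hR1 hR2 using fun g : Polynomial A => pdiv f g
      set K := insert f.derivative L0 with hK
      set H := K.biUnion T with hH
      set R2 : Polynomial A → Polynomial A := fun g => Polynomial.C (g.leadingCoeff ^ (N g)) * R g
        with hR2def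
      set L1 := H ∪ H.image R2 with hL1
      have hder : f.derivative.natDegree ≤ d := by
        have := Polynomial.natDegree_derivative_le f; omega
      have hKd : ∀ q ∈ K, q.natDegree ≤ d + 1 := by
        intro q hq
        rcases Finset.mem_insert.1 hq with rfl | hq
        · omega
        · exact hL0d q hq
      have hHd : ∀ q ∈ H, q ∈ L0 ∨ q.natDegree ≤ d := by
        intro q hq
        obtain ⟨g, hg, hqg⟩ := Finset.mem_biUnion.1 hq
        have h1 := hKd g hg
        rcases hT2 g q hqg with rfl | h2
        · rcases Finset.mem_insert.1 hg with rfl | hg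
          · right; exact hder
          · left; exact hg
        · right; omega
      have hHd' : ∀ q ∈ H, q.natDegree ≤ d + 1 := by
        intro q hq
        rcases hHd q hq with h | h
        · exact hL0d q h
        · omega
      have hL1d : ∀ q ∈ L1, q ∈ L0 ∨ q.natDegree ≤ d := by
        intro q hq
        rcases Finset.mem_union.1 hq with hq | hq
        · exact hHd q hq
        · obtain ⟨g, hg, rfl⟩ := Finset.mem_image.1 hq
          right
          have h1 := hR2 g
          have h2 := hHd' g hg
          have h3 : (R2 g).natDegree ≤ (R g).natDegree := Polynomial.natDegree_C_mul_le _ _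
          omega
      obtain ⟨D1, hD1⟩ := ihk L1 (by
        intro q hq
        rcases hL1d q hq with h | h
        · exact hL0d q h
        · omega) (by
        refine le_trans (Finset.card_le_card ?_) hcard0
        intro q hq
        rw [Finset.mem_filter] at hq
        rcases hL1d q hq.1 with h | h
        · exact Finset.mem_filter.2 ⟨h, hq.2⟩
        · omega)
      refine ⟨insert f.leadingCoeff (D0 ∪ D1 ∪ H.image Polynomial.leadingCoeff), ?_⟩
      intro e e' hD
      have hlc := hD _ (Finset.mem_insert_self _ _)
      by_cases hz : e f.leadingCoeff = 0
      · have hz' : e' f.leadingCoeff = 0 := by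
          rw [hz, sign_zero] at hlc
          exact sign_eq_zero_iff.1 hlc.symm
        obtain ⟨G, hG, hm⟩ := hD0 e e' (fun d hd => hD d (by simp [hd]))
        refine ⟨G, hG, fun y y' hr q hq => ?_⟩
        rw [← hins] at hq
        rcases Finset.mem_insert.1 hq with rfl | hq
        · rw [map_eq_eraseLead _ e hz, map_eq_eraseLead _ e' hz']
          exact hm y y' hr _ (Finset.mem_insert_self _ _)
        · exact hm y y' hr q (Finset.mem_insert_of_mem hq)
      · obtain ⟨G1, hm⟩ := hD1 e e' (fun d hd => hD d (by simp [hd]))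
        rw [← hins]
        refine tarski_step (H := H) (L1 := L1) Finset.subset_union_left ?_ ?_ ?_ hm
        · intro g hg
          have hTH : T g ⊆ H := Finset.subset_biUnion_of_mem T hg
          rcases hT3 g e e' (by
            intro t ht
            have := hD t.leadingCoeff (by
              refine Finset.mem_insert_of_mem (Finset.mem_union_right _ ?_)
              exact Finset.mem_image_of_mem _ (hTH ht))
            rw [← sign_eq_zero_iff, this, sign_eq_zero_iff]) with h | ⟨t, ht, h⟩
          · left; exact h
          · right; exact ⟨t, hTH ht, h⟩
        · intro g hg hg0
          refine ⟨N g + N g, Polynomial.C (g.leadingCoeff ^ (N g)) * Q g, R2 g,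
            Finset.mem_union_right _ (Finset.mem_image_of_mem _ hg), ?_, ⟨N g, rfl⟩⟩
          rw [pow_add, Polynomial.C_mul, mul_assoc, hR1 g hg0]
          simp only [hR2def]
          ring
        · intro h0
          apply hz
          have := congrArg (fun p => Polynomial.coeff p d) h0
          simp only [Polynomial.coeff_map, Polynomial.coeff_derivative, Polynomial.coeff_zero,
            map_mul] at this
          rw [Polynomial.leadingCoeff, hfd]
          rcases mul_eq_zero.1 this with h | h
          · exact h
          · exfalso
            have h2 : e ((d:A) + 1) = (d:ℝ) + 1 := by simp
            rw [h2] at h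
            have : (0:ℝ) ≤ d := Nat.cast_nonneg d
            linarith

theorem tarski_one (L : Finset (Polynomial A)) : ∃ D : Finset A, ∀ e e' : A →+* ℝ,
    (∀ d ∈ D, SignType.sign (e d) = SignType.sign (e' d)) → ∀ y, ∃ y', ∀ q ∈ L,
    SignType.sign ((q.map e).eval y) = SignType.sign ((q.map e').eval y') := by
  obtain ⟨D, hD⟩ := tarski_ind (L.sup Polynomial.natDegree) _ L
    (fun q hq => Finset.le_sup (f := Polynomial.natDegree) hq) le_rfl
  refine ⟨D, fun e e' h y => ?_⟩
  obtain ⟨G, hG, hm⟩ := hD e e' h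
  obtain ⟨y', hy'⟩ := hG.across y
  exact ⟨y', hm y y' hy'⟩

end TarskiAlg2

theorem tarski_many {B : Type*} [CommRing B] [IsDomain B] : ∀ (n : ℕ)
    (L : Finset (MvPolynomial (Fin n) B)), ∃ D : Finset B, ∀ e e' : B →+* ℝ,
    (∀ d ∈ D, SignType.sign (e d) = SignType.sign (e' d)) → ∀ x : Fin n → ℝ, ∃ x' : Fin n → ℝ,
    ∀ q ∈ L, SignType.sign (q.eval₂ e x) = SignType.sign (q.eval₂ e' x') := by
  classical
  intro n
  induction n with
  | zero =>
    intro L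
    refine ⟨L.image (fun q => q.coeff 0), fun e e' h x => ⟨x, fun q hq => ?_⟩⟩
    rw [MvPolynomial.eq_C_of_isEmpty q]
    simp only [MvPolynomial.eval₂_C]
    exact h _ (Finset.mem_image_of_mem _ hq)
  | succ n ih =>
    intro L
    obtain ⟨D1, hD1⟩ := tarski_one (L.image (MvPolynomial.finSuccEquiv B n))
    obtain ⟨D, hD⟩ := ih D1
    refine ⟨D, fun e e' h x => ?_⟩
    obtain ⟨x0', hx0'⟩ := hD e e' h (fun i => x i.succ)
    obtain ⟨y', hy'⟩ := hD1 (MvPolynomial.eval₂Hom e (fun i => x i.succ))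
      (MvPolynomial.eval₂Hom e' x0') (fun d hd => hx0' d hd) (x 0)
    refine ⟨Fin.cons y' x0', fun q hq => ?_⟩
    have key : ∀ (i : B →+* ℝ) (v : Fin n → ℝ) (y : ℝ), q.eval₂ i (Fin.cons y v : Fin (n+1) → ℝ) =
        ((MvPolynomial.finSuccEquiv B n q).map (MvPolynomial.eval₂Hom i v)).eval y := by
      intro i v y
      have : MvPolynomial.eval₂Hom i (Fin.cons y v : Fin (n+1) → ℝ) =
          ((Polynomial.evalRingHom y).comp (Polynomial.mapRingHom (MvPolynomial.eval₂Hom i v))).comp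
            ((MvPolynomial.finSuccEquiv B n : _ →+* _)) := by
        refine MvPolynomial.ringHom_ext (fun r => ?_) (fun j => ?_)
        · simp [MvPolynomial.finSuccEquiv_apply]
        · refine Fin.cases ?_ (fun j => ?_) j
          · simp [MvPolynomial.finSuccEquiv_apply]
          · simp [MvPolynomial.finSuccEquiv_apply]
      exact congrArg (fun h => h q) this
    have hx : x = Fin.cons (x 0) (fun i => x i.succ) := by
      funext i; refine Fin.cases ?_ (fun j => ?_) i <;> simp
    rw [hx, key, key]
    exact hy' _ (Finset.mem_image_of_mem _ hq)

lemma poly_up (c : Polynomial ℝ) : ∃ K : ℕ, ∀ᶠ t : ℝ in Filter.atTop, |c.eval t| ≤ t ^ K := by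
  refine ⟨c.natDegree + 1, ?_⟩
  have h := Polynomial.div_tendsto_atTop_zero_of_degree_lt c (Polynomial.X ^ (c.natDegree + 1)) (by
    rw [Polynomial.degree_X_pow]
    exact lt_of_le_of_lt Polynomial.degree_le_natDegree (by exact_mod_cast Nat.lt_succ_self _))
  have h1 := h.eventually (Metric.ball_mem_nhds (0:ℝ) one_pos)
  filter_upwards [h1, Filter.eventually_gt_atTop (0:ℝ)] with t ht ht0
  rw [dist_zero_right, Real.norm_eq_abs, abs_div] at ht
  simp only [Polynomial.eval_pow, Polynomial.eval_X] at ht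
  have hp : 0 < t ^ (c.natDegree + 1) := by positivity
  rw [abs_of_pos hp, div_lt_one hp] at ht
  exact ht.le

lemma poly_low (c : Polynomial ℝ) (hc : c ≠ 0) : ∀ᶠ t : ℝ in Filter.atTop, 1 ≤ t * |c.eval t| := by
  have h := Polynomial.abs_tendsto_atTop (Polynomial.X * c) (by
    rw [Polynomial.degree_mul, Polynomial.degree_X, Polynomial.degree_eq_natDegree hc]
    exact_mod_cast Nat.lt_of_lt_of_le one_pos (Nat.le_add_right _ _))
  filter_upwards [h.eventually_ge_atTop 1, Filter.eventually_gt_atTop (0:ℝ)] with t ht ht0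
  simpa [abs_mul, abs_of_pos ht0] using ht

lemma growth_one (d : Polynomial (Polynomial ℝ)) (hd : d ≠ 0) :
    ∃ N : ℕ, ∀ᶠ t : ℝ in Filter.atTop, ∀ w, t ^ N ≤ w → d.evalEval t w ≠ 0 := by
  choose K hK using fun k => poly_up (d.coeff k)
  set M := (Finset.range d.natDegree).sup K with hM
  have hlc := poly_low d.leadingCoeff (Polynomial.leadingCoeff_ne_zero.2 hd)
  have hall : ∀ᶠ t : ℝ in Filter.atTop, ∀ k ∈ Finset.range d.natDegree,
      |(d.coeff k).eval t| ≤ t ^ (K k) := by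
    rw [Filter.eventually_all_finset]
    exact fun k _ => hK k
  refine ⟨M + 2, ?_⟩
  filter_upwards [hlc, hall, Filter.eventually_ge_atTop (2:ℝ)] with t h1 h2 h3 w hw h0
  have ht0 : 0 < t := by linarith
  have hl : Polynomial.evalRingHom t d.leadingCoeff ≠ 0 := by
    intro h
    rw [Polynomial.coe_evalRingHom] at h
    rw [h] at h1; norm_num at h1
  set p := d.map (Polynomial.evalRingHom t) with hp
  have hdeg : p.natDegree = d.natDegree := Polynomial.natDegree_map_of_leadingCoeff_ne_zero _ hl
  have hlead : p.leadingCoeff = d.leadingCoeff.eval t :=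
    Polynomial.leadingCoeff_map_of_leadingCoeff_ne_zero _ hl
  have hpne : p ≠ 0 := by
    intro h
    rw [h, Polynomial.leadingCoeff_zero] at hlead
    exact hl hlead.symm
  have hroot : p.IsRoot w := by
    rw [Polynomial.IsRoot, hp, Polynomial.map_evalRingHom_eval]; exact h0
  have hb := hroot.norm_lt_cauchyBound hpne
  rw [Polynomial.cauchyBound, hdeg, hlead] at hb
  have hs : (Finset.range d.natDegree).sup (fun k => ‖p.coeff k‖₊) ≤ Real.toNNReal (t ^ M) := by
    refine Finset.sup_le (fun k hk => ?_)
    apply NNReal.coe_le_coe.1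
    rw [Real.coe_toNNReal _ (by positivity)]
    have e1 : p.coeff k = (d.coeff k).eval t := by rw [hp, Polynomial.coeff_map]; rfl
    have e2 : t ^ (K k) ≤ t ^ M := pow_le_pow_right₀ (by linarith) (Finset.le_sup (f := K) hk)
    rw [coe_nnnorm, e1, Real.norm_eq_abs]
    exact (h2 k hk).trans e2
  rw [← NNReal.coe_lt_coe] at hb
  rw [← NNReal.coe_le_coe, Real.coe_toNNReal _ (by positivity)] at hs
  simp only [NNReal.coe_add, NNReal.coe_div, coe_nnnorm, Real.norm_eq_abs, NNReal.coe_one] at hb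
  have hlp : 0 < |d.leadingCoeff.eval t| := abs_pos.2 hl
  have h4 : ((Finset.range d.natDegree).sup (fun k => ‖p.coeff k‖₊) : NNReal) / |d.leadingCoeff.eval t|
      ≤ t ^ M * t := by
    rw [div_le_iff₀ hlp]
    have : t ^ M ≤ t ^ M * (t * |d.leadingCoeff.eval t|) := le_mul_of_one_le_right (by positivity) h1
    refine le_trans hs ?_
    linarith
  have h5 : w < t ^ M * t + 1 := lt_of_le_of_lt (le_abs_self w) (lt_of_lt_of_le hb (by linarith))
  have h6 : 1 ≤ t ^ M := one_le_pow₀ (by linarith)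
  have h7 : t ^ (M+2) = t ^ M * t * t := by ring
  nlinarith [mul_pos (lt_of_lt_of_le one_pos h6) ht0]

lemma growth_all (D : Finset (Polynomial (Polynomial ℝ))) :
    ∃ N : ℕ, ∀ᶠ t : ℝ in Filter.atTop, ∀ d ∈ D, d ≠ 0 → ∀ w, t ^ N ≤ w → d.evalEval t w ≠ 0 := by
  have : ∀ d : Polynomial (Polynomial ℝ), ∃ N : ℕ, ∀ᶠ t : ℝ in Filter.atTop, d ≠ 0 →
      ∀ w, t ^ N ≤ w → d.evalEval t w ≠ 0 := by
    intro d
    by_cases hd : d = 0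
    · exact ⟨0, Filter.Eventually.of_forall (fun t h => (h hd).elim)⟩
    · obtain ⟨N, hN⟩ := growth_one d hd
      exact ⟨N, hN.mono (fun t h _ => h)⟩
  choose N hN using this
  refine ⟨D.sup N, ?_⟩
  have hall : ∀ᶠ t : ℝ in Filter.atTop, ∀ d ∈ D, d ≠ 0 →
      ∀ w, t ^ (N d) ≤ w → d.evalEval t w ≠ 0 := by
    rw [Filter.eventually_all_finset]
    exact fun d _ => hN d
  filter_upwards [hall, Filter.eventually_ge_atTop (1:ℝ)] with t h1 h2 d hd hd0 w hw
  exact h1 d hd hd0 w (le_trans (pow_le_pow_right₀ h2 (Finset.le_sup (f := N) hd)) hw)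

lemma lojasiewicz {n : ℕ} (s g u h : MvPolynomial (Fin n) ℝ)
    (hyp : ∀ R : ℝ, ∃ δ > 0, ∀ x : Fin n → ℝ, eval x s = 0 → eval x g ≠ 0 → eval x u ≤ 0 →
      1 ≤ R * eval x h → ∑ i, x i ^ 2 ≤ R → δ ≤ eval x g ^ 2) :
    ∃ (N : ℕ) (T : ℝ), 1 ≤ T ∧ ∀ t, T ≤ t → ∀ x : Fin n → ℝ, eval x s = 0 → eval x g ≠ 0 →
      eval x u ≤ 0 → 1 ≤ t * eval x h → ∑ i, x i ^ 2 ≤ t → 1 < t ^ N * eval x g ^ 2 := by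
  classical
  set φ : ℝ →+* Polynomial (Polynomial ℝ) := Polynomial.C.comp Polynomial.C with hφ
  set tt : MvPolynomial (Fin n) (Polynomial (Polynomial ℝ)) := C (Polynomial.C Polynomial.X)
  set ww : MvPolynomial (Fin n) (Polynomial (Polynomial ℝ)) := C Polynomial.X
  have hev : ∀ (t w : ℝ) (x : Fin n → ℝ) (p : MvPolynomial (Fin n) ℝ),
      (MvPolynomial.map φ p).eval₂ (Polynomial.evalEvalRingHom t w) x = eval x p := by
    intro t w x p
    rw [eval₂_map]
    have : (Polynomial.evalEvalRingHom t w).comp φ = RingHom.id ℝ := by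
      ext r; simp [hφ]
    rw [this]; rfl
  have htt : ∀ (t w : ℝ) (x : Fin n → ℝ), tt.eval₂ (Polynomial.evalEvalRingHom t w) x = t := by
    intro t w x; simp [tt]
  have hww : ∀ (t w : ℝ) (x : Fin n → ℝ), ww.eval₂ (Polynomial.evalEvalRingHom t w) x = w := by
    intro t w x; simp [ww]
  set q4 := tt * MvPolynomial.map φ h - 1
  set q5 := tt - MvPolynomial.map φ (∑ i, X i ^ 2)
  set q6 := 1 - ww * MvPolynomial.map φ (g ^ 2)
  have h4 : ∀ (t w : ℝ) (x : Fin n → ℝ), q4.eval₂ (Polynomial.evalEvalRingHom t w) x =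
      t * eval x h - 1 := by
    intro t w x; simp only [q4, eval₂_sub, eval₂_mul, htt, hev, eval₂_one]
  have h5 : ∀ (t w : ℝ) (x : Fin n → ℝ), q5.eval₂ (Polynomial.evalEvalRingHom t w) x =
      t - ∑ i, x i ^ 2 := by
    intro t w x; simp only [q5, eval₂_sub, htt, hev]; simp
  have h6 : ∀ (t w : ℝ) (x : Fin n → ℝ), q6.eval₂ (Polynomial.evalEvalRingHom t w) x =
      1 - w * eval x g ^ 2 := by
    intro t w x; simp only [q6, eval₂_sub, eval₂_mul, hww, hev, eval₂_one]; simp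
  obtain ⟨D, hD⟩ := tarski_many n ({MvPolynomial.map φ s, MvPolynomial.map φ g,
    MvPolynomial.map φ u, q4, q5, q6} : Finset (MvPolynomial (Fin n) (Polynomial (Polynomial ℝ))))
  obtain ⟨N, hN⟩ := growth_all D
  obtain ⟨T, hT⟩ := Filter.eventually_atTop.1 hN
  refine ⟨N, max 1 T, le_max_left _ _, ?_⟩
  intro t ht x xs xg xu xh xt
  by_contra hcon
  rw [not_lt] at hcon
  obtain ⟨δ, hδ, hδ2⟩ := hyp t
  set w := max (t ^ N) (2 / δ)
  obtain ⟨x', hx'⟩ := hD (Polynomial.evalEvalRingHom t (t ^ N)) (Polynomial.evalEvalRingHom t w) (by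
    intro d hd
    by_contra hne
    have hd0 : d ≠ 0 := by rintro rfl; simp at hne
    rw [Polynomial.coe_evalEvalRingHom, Polynomial.coe_evalEvalRingHom,
      ← Polynomial.map_evalRingHom_eval, ← Polynomial.map_evalRingHom_eval] at hne
    obtain ⟨c, hc, hc0⟩ := sign_ne_root _ hne
    rw [uIcc_of_le (le_max_left _ _)] at hc
    rw [Polynomial.map_evalRingHom_eval] at hc0
    exact hT t (le_trans (le_max_right _ _) ht) d hd hd0 c hc.1 hc0) x
  have k1 := hx' (MvPolynomial.map φ s) (by simp)
  have k2 := hx' (MvPolynomial.map φ g) (by simp)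
  have k3 := hx' (MvPolynomial.map φ u) (by simp)
  have k4 := hx' q4 (by simp)
  have k5 := hx' q5 (by simp)
  have k6 := hx' q6 (by simp)
  have tr : ∀ a b : ℝ, SignType.sign a = SignType.sign b → 0 ≤ a → 0 ≤ b := by
    intro a b hab ha
    rw [← sign_nonneg_iff] at ha ⊢
    rwa [← hab]
  rw [hev, hev, xs, sign_zero] at k1
  rw [hev, hev] at k2 k3
  rw [h4, h4] at k4
  rw [h5, h5] at k5
  rw [h6, h6] at k6
  have m1 := sign_eq_zero_iff.1 k1.symm
  have m2 : eval x' g ≠ 0 := by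
    intro h0; rw [h0, sign_zero] at k2; exact xg (sign_eq_zero_iff.1 k2)
  have m3 : eval x' u ≤ 0 := by
    rw [← sign_nonpos_iff] at xu ⊢; rwa [← k3]
  have m4 := tr _ _ k4 (by linarith)
  have m5 := tr _ _ k5 (by linarith)
  have m6 := tr _ _ k6 (by linarith)
  have m7 := hδ2 x' m1 m2 m3 (by linarith) (by linarith)
  have m8 : 2 / δ ≤ w := le_max_right _ _
  rw [div_le_iff₀ hδ] at m8
  have hwpos : 0 ≤ w := le_trans (by positivity) (le_max_right (t^N) (2/δ))
  nlinarith [mul_le_mul_of_nonneg_left m7 hwpos]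

lemma coeff_of_tendsto (m : ℕ) : ∀ (P : Polynomial ℝ) (G : ℝ → ℝ) (c : ℝ),
    Filter.Tendsto G (nhdsWithin 0 {0}ᶜ) (nhds c) → (∀ t, t ≠ 0 → P.eval t = t ^ m * G t) →
    P.coeff m = c := by
  induction m with
  | zero =>
    intro P G c hG h
    have h1 : Filter.Tendsto (fun t => P.eval t) (nhdsWithin 0 {0}ᶜ) (nhds (P.eval 0)) :=
      (P.continuous.tendsto 0).mono_left nhdsWithin_le_nhds
    have h2 : Filter.Tendsto (fun t => P.eval t) (nhdsWithin 0 {0}ᶜ) (nhds c) := by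
      refine hG.congr' ?_
      filter_upwards [self_mem_nhdsWithin] with t ht
      rw [h t ht, pow_zero, one_mul]
    rw [Polynomial.coeff_zero_eq_eval_zero]
    exact tendsto_nhds_unique h1 h2
  | succ m ih =>
    intro P G c hG h
    have h1 : Filter.Tendsto (fun t => P.eval t) (nhdsWithin 0 {0}ᶜ) (nhds (P.eval 0)) :=
      (P.continuous.tendsto 0).mono_left nhdsWithin_le_nhds
    have h2 : Filter.Tendsto (fun t => P.eval t) (nhdsWithin 0 {0}ᶜ) (nhds 0) := by
      have h3 : Filter.Tendsto (fun t : ℝ => t ^ (m+1)) (nhdsWithin 0 {0}ᶜ) (nhds (0 ^ (m+1))) :=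
        ((continuous_pow (m+1)).tendsto 0).mono_left nhdsWithin_le_nhds
      have h4 := h3.mul hG
      rw [zero_pow (Nat.succ_ne_zero m), zero_mul] at h4
      refine h4.congr' ?_
      filter_upwards [self_mem_nhdsWithin] with t ht
      rw [h t ht]
    have h0 : P.coeff 0 = 0 := by
      rw [Polynomial.coeff_zero_eq_eval_zero]; exact tendsto_nhds_unique h1 h2
    have hP : P = Polynomial.X * P.divX := by
      conv_lhs => rw [← Polynomial.X_mul_divX_add P, h0, map_zero, add_zero]
    rw [← Polynomial.coeff_divX]
    refine ih P.divX G c hG (fun t ht => ?_)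
    have h5 := h t ht
    rw [hP, Polynomial.eval_mul, Polynomial.eval_X, pow_succ'] at h5
    exact mul_left_cancel₀ ht (by rw [h5]; ring)

noncomputable def lineHom {n : ℕ} (v : Fin n → ℝ) :
    MvPolynomial (Fin n) ℝ →+* Polynomial (MvPolynomial (Fin n) ℝ) :=
  MvPolynomial.eval₂Hom (Polynomial.C.comp MvPolynomial.C)
    (fun i => Polynomial.C (X i) + Polynomial.C (C (v i)) * Polynomial.X)

lemma lineHom_eval {n : ℕ} (v x : Fin n → ℝ) (t : ℝ) (q : MvPolynomial (Fin n) ℝ) :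
    ((lineHom v q).map (eval x)).eval t = eval (x + t • v) q := by
  have : ((Polynomial.evalRingHom t).comp (Polynomial.mapRingHom (eval x))).comp (lineHom v)
      = eval (x + t • v) := by
    refine MvPolynomial.ringHom_ext (fun r => ?_) (fun j => ?_)
    · simp [lineHom]
    · simp [lineHom]; ring
  exact congrArg (fun h => h q) this

lemma line_ne {n : ℕ} (r : MvPolynomial (Fin n) ℝ) (x y : Fin n → ℝ) (hy : eval y r ≠ 0) :
    ∀ᶠ t in nhdsWithin (0:ℝ) {0}ᶜ, eval (x + t • (y - x)) r ≠ 0 := by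
  set R := (lineHom (y - x) r).map (eval x) with hR
  have hne : R ≠ 0 := by
    intro h
    have := lineHom_eval (y - x) x 1 r
    rw [← hR, h] at this
    simp at this
    exact hy this.symm
  have hfin : (R.rootSet ℝ).Finite := R.rootSet_finite ℝ
  have h1 : ∀ᶠ t in nhdsWithin (0:ℝ) {0}ᶜ, t ∉ (R.rootSet ℝ \ {0}) := by
    refine Filter.Eventually.filter_mono nhdsWithin_le_nhds ?_
    have hcl : IsClosed (R.rootSet ℝ \ {0}) := (hfin.subset sdiff_subset).isClosed
    exact hcl.isOpen_compl.mem_nhds (by simp)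
  filter_upwards [h1, self_mem_nhdsWithin] with t ht ht0 h0
  apply ht
  refine ⟨?_, ht0⟩
  rw [Polynomial.mem_rootSet]
  refine ⟨hne, ?_⟩
  rw [Polynomial.coe_aeval_eq_eval, hR, lineHom_eval, h0]

lemma line_tendsto {n : ℕ} (x v : Fin n → ℝ) (G : (Fin n → ℝ) → ℝ) (hG : Continuous G) :
    Filter.Tendsto (fun t : ℝ => G (x + t • v)) (nhdsWithin (0:ℝ) {0}ᶜ) (nhds (G x)) := by
  have h : Continuous (fun t : ℝ => G (x + t • v)) := by fun_prop
  have := (h.tendsto 0).mono_left (nhdsWithin_le_nhds (s := {0}ᶜ))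
  simpa using this

lemma zero_of_dense {n : ℕ} (r : MvPolynomial (Fin n) ℝ) {y : Fin n → ℝ} (hy : eval y r ≠ 0)
    (G : (Fin n → ℝ) → ℝ) (hG : Continuous G) (h : ∀ x, eval x r ≠ 0 → G x = 0) (x : Fin n → ℝ) :
    G x = 0 := by
  have h1 := line_tendsto x (y - x) G hG
  have h2 : Filter.Tendsto (fun t : ℝ => G (x + t • (y - x))) (nhdsWithin (0:ℝ) {0}ᶜ) (nhds 0) := by
    refine tendsto_const_nhds.congr' ?_
    filter_upwards [line_ne r x y hy] with t ht
    rw [h _ ht]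
  exact tendsto_nhds_unique h1 h2

lemma regulous_global {n : ℕ} (F : (Fin n → ℝ) → ℝ) (hF : IsRegulous F) :
    ∃ (p q : MvPolynomial (Fin n) ℝ) (y : Fin n → ℝ), eval y q ≠ 0 ∧
      ∀ x, F x * eval x q = eval x p := by
  obtain ⟨hc, U, ⟨_, k, P, hP⟩, ⟨y, hy⟩, p, q, hq, hpq⟩ := hF
  refine ⟨p, q, y, hq y hy, fun x => ?_⟩
  have hy' : y ∉ (univ \ U) := fun h => h.2 hy
  rw [hP] at hy'
  simp only [mem_ofPred_eq, not_forall] at hy'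
  obtain ⟨i, hi⟩ := hy'
  have := zero_of_dense (P i) hi (fun x => F x * eval x q - eval x p)
    ((hc.mul (MvPolynomial.continuous_eval q)).sub (MvPolynomial.continuous_eval p)) (by
      intro z hz
      have hzU : z ∈ U := by
        by_contra hn
        have : z ∈ univ \ U := ⟨trivial, hn⟩
        rw [hP] at this
        exact hz (this i)
      show F z * eval z q - eval z p = 0
      rw [hpq z hzU, div_mul_cancel₀ _ (hq z hzU), sub_self]) x
  linarith

lemma line_lemma {n : ℕ} (F : (Fin n → ℝ) → ℝ) (hF : IsRegulous F) (V : Set (Fin n → ℝ))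
    (hV : V.Nonempty) : ∃ P Q : MvPolynomial (Fin n) ℝ, (∃ x ∈ V, eval x Q ≠ 0) ∧
      ∀ x ∈ V, F x * eval x Q = eval x P := by
  classical
  obtain ⟨p, q, y, hy, hpq⟩ := regulous_global F hF
  obtain ⟨x0, hx0⟩ := hV
  set v := y - x0
  have hex : ∃ m, ∃ x ∈ V, eval x ((lineHom v q).coeff m) ≠ 0 := by
    by_contra hn
    push Not at hn
    apply hy
    have h1 := lineHom_eval v x0 1 q
    have h2 : (lineHom v q).map (eval x0) = 0 := by
      ext k
      rw [Polynomial.coeff_map, hn k x0 hx0, Polynomial.coeff_zero]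
    rw [h2] at h1
    simpa [v] using h1.symm
  set m := Nat.find hex
  refine ⟨(lineHom v p).coeff m, (lineHom v q).coeff m, Nat.find_spec hex, fun x hx => ?_⟩
  have hdvd : Polynomial.X ^ m ∣ (lineHom v q).map (eval x) := by
    rw [Polynomial.X_pow_dvd_iff]
    intro d hd
    rw [Polynomial.coeff_map]
    by_contra hne
    exact Nat.find_min hex hd ⟨x, hx, hne⟩
  obtain ⟨A, hA⟩ := hdvd
  have hA0 : A.eval 0 = eval x ((lineHom v q).coeff m) := by
    rw [← Polynomial.coeff_map, hA, ← Polynomial.coeff_zero_eq_eval_zero]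
    have := Polynomial.coeff_X_pow_mul A m 0
    rw [zero_add] at this
    exact this.symm
  have hT : Filter.Tendsto (fun t : ℝ => F (x + t • v) * A.eval t) (nhdsWithin (0:ℝ) {0}ᶜ)
      (nhds (F x * A.eval 0)) :=
    (line_tendsto x v F hF.1).mul ((A.continuous.tendsto 0).mono_left nhdsWithin_le_nhds)
  have := coeff_of_tendsto m ((lineHom v p).map (eval x)) _ _ hT (by
    intro t _
    rw [lineHom_eval, ← hpq, ← lineHom_eval v x t q, hA]
    simp only [Polynomial.eval_mul, Polynomial.eval_pow, Polynomial.eval_X]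
    ring)
  rw [← hA0, ← this, Polynomial.coeff_map]

lemma sign_eq_of_mul_pos {a b : ℝ} (h : 0 < a * b) : SignType.sign a = SignType.sign b := by
  rcases pos_and_pos_or_neg_and_neg_of_mul_pos h with ⟨h1, h2⟩ | ⟨h1, h2⟩
  · rw [sign_pos h1, sign_pos h2]
  · rw [sign_neg h1, sign_neg h2]

lemma mul_pos_of_sign_eq {a b : ℝ} (h : SignType.sign a = SignType.sign b) (ha : a ≠ 0) :
    0 < a * b := by
  rcases lt_or_gt_of_ne ha with h1 | h1
  · rw [sign_neg h1] at h
    exact mul_pos_of_neg_of_neg h1 (sign_eq_neg_one_iff.1 h.symm)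
  · rw [sign_pos h1] at h
    exact mul_pos h1 (sign_eq_one_iff.1 h.symm)

lemma ideal_sos {n : ℕ} (I : Ideal (MvPolynomial (Fin n) ℝ)) :
    ∃ s : MvPolynomial (Fin n) ℝ, ∀ x, (eval x s = 0 ↔ ∀ p ∈ I, eval x p = 0) := by
  obtain ⟨S, hS⟩ := (IsNoetherian.noetherian I : I.FG)
  refine ⟨∑ a ∈ S, a ^ 2, fun x => ?_⟩
  have h1 : eval x (∑ a ∈ S, a ^ 2) = ∑ a ∈ S, (eval x a) ^ 2 := by simp
  rw [h1, Finset.sum_eq_zero_iff_of_nonneg (fun _ _ => sq_nonneg _)]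
  constructor
  · intro h p hp
    have hle : I ≤ RingHom.ker (eval x) := by
      rw [← hS, Submodule.span_le]
      intro a ha
      exact pow_eq_zero_iff (two_ne_zero) |>.1 (h a ha)
    exact hle hp
  · intro h a ha
    have : a ∈ I := by rw [← hS]; exact Submodule.subset_span ha
    rw [h a this]; norm_num

lemma bdd_sq {n : ℕ} (R : ℝ) : Bornology.IsBounded {x : Fin n → ℝ | ∑ i, x i ^ 2 ≤ R} := by
  refine (Metric.isBounded_closedBall (x := (0 : Fin n → ℝ)) (r := |R| + 1)).subset ?_
  intro x hx
  rw [mem_closedBall_zero_iff, pi_norm_le_iff_of_nonneg (by positivity)]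
  intro i
  have h1 : x i ^ 2 ≤ ∑ i, x i ^ 2 :=
    Finset.single_le_sum (f := fun i => x i ^ 2) (fun _ _ => sq_nonneg _) (Finset.mem_univ i)
  have h2 : x i ^ 2 ≤ R := h1.trans hx
  rw [Real.norm_eq_abs]
  have h3 := le_abs_self R
  have h4 := abs_nonneg R
  apply abs_le_of_sq_le_sq' _ _ |> abs_le.2
  · nlinarith
  · positivity

theorem sep {n : ℕ} (F : (Fin n → ℝ) → ℝ) (hF : IsRegulous F) (h : MvPolynomial (Fin n) ℝ)
    (h0 : ∀ x, 0 ≤ eval x h) : ∀ I : Ideal (MvPolynomial (Fin n) ℝ),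
    (∀ x, (∀ p ∈ I, eval x p = 0) → (F x = 0 ↔ eval x h = 0)) →
    ∃ p : MvPolynomial (Fin n) ℝ, ∀ x, (∀ p ∈ I, eval x p = 0) →
      SignType.sign (F x) = SignType.sign (eval x p) := by
  intro I
  induction I using WellFoundedGT.induction with
  | ind I ih =>
  intro hI
  by_cases hV : {x : Fin n → ℝ | ∀ p ∈ I, eval x p = 0}.Nonempty
  swap
  · exact ⟨0, fun x hx => (hV ⟨x, hx⟩).elim⟩
  obtain ⟨P, Q, ⟨x1, hx1, hQ1⟩, hPQ⟩ := line_lemma F hF _ hV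
  have hlt : I < I ⊔ Ideal.span {Q} := by
    refine lt_of_le_of_ne le_sup_left (fun he => hQ1 (hx1 Q ?_))
    rw [he]
    exact Ideal.mem_sup_right (Ideal.subset_span rfl)
  have hJ : ∀ x, (∀ p ∈ I ⊔ Ideal.span {Q}, eval x p = 0) ↔
      ((∀ p ∈ I, eval x p = 0) ∧ eval x Q = 0) := by
    intro x
    constructor
    · intro hx
      exact ⟨fun p hp => hx p (Ideal.mem_sup_left hp), hx Q (Ideal.mem_sup_right (Ideal.subset_span rfl))⟩
    · rintro ⟨h1, h2⟩ p hp
      have hle : I ⊔ Ideal.span {Q} ≤ RingHom.ker (eval x) := by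
        refine sup_le (fun a ha => h1 a ha) ?_
        rw [Ideal.span_le, singleton_subset_iff]
        exact h2
      exact hle hp
  obtain ⟨p1, hp1⟩ := ih _ hlt (fun x hx => hI x ((hJ x).1 hx).1)
  obtain ⟨s, hs⟩ := ideal_sos I
  set g := P * Q with hg
  have hgx : ∀ x, eval x s = 0 → eval x g = F x * eval x Q ^ 2 := by
    intro x hx
    rw [hg, eval_mul, ← hPQ x ((hs x).1 hx)]; ring
  have hp1' : ∀ x, eval x s = 0 → eval x Q = 0 → SignType.sign (F x) = SignType.sign (eval x p1) :=
    fun x hx hq => hp1 x ((hJ x).2 ⟨(hs x).1 hx, hq⟩)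
  have hI' : ∀ x, eval x s = 0 → (F x = 0 ↔ eval x h = 0) := fun x hx => hI x ((hs x).1 hx)
  obtain ⟨N, T, hT1, hloj⟩ := lojasiewicz s g (p1 * g) h (by
    intro R
    set K := {x : Fin n → ℝ | eval x s = 0 ∧ F x * eval x p1 ≤ 0 ∧ 1 ≤ R * eval x h ∧
      ∑ i, x i ^ 2 ≤ R} with hKdef
    have hcs := MvPolynomial.continuous_eval s
    have hcp := MvPolynomial.continuous_eval p1
    have hch := MvPolynomial.continuous_eval h
    have hcg := MvPolynomial.continuous_eval g
    have hFc := hF.1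
    have hKc : IsCompact K := by
      refine Metric.isCompact_of_isClosed_isBounded ?_ ((bdd_sq R).subset (fun x hx => hx.2.2.2))
      have c4 : IsClosed {x : Fin n → ℝ | ∑ i, x i ^ 2 ≤ R} :=
        isClosed_le (by fun_prop) continuous_const
      have c1 : IsClosed {x : Fin n → ℝ | eval x s = 0} := isClosed_eq hcs continuous_const
      have c2 : IsClosed {x : Fin n → ℝ | F x * eval x p1 ≤ 0} :=
        isClosed_le (hFc.mul hcp) continuous_const
      have c3 : IsClosed {x : Fin n → ℝ | 1 ≤ R * eval x h} :=
        isClosed_le continuous_const (continuous_const.mul hch)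
      exact c1.inter (c2.inter (c3.inter c4))
    have hKg : ∀ x ∈ K, 0 < eval x g ^ 2 := by
      rintro x ⟨k1, k2, k3, _⟩
      have hh : eval x h ≠ 0 := by intro h; rw [h] at k3; linarith
      have hFx : F x ≠ 0 := fun hz => hh ((hI' x k1).1 hz)
      have hQx : eval x Q ≠ 0 := by
        intro hz
        have := mul_pos_of_sign_eq (hp1' x k1 hz) hFx
        linarith
      have : eval x g ≠ 0 := by
        rw [hgx x k1]; exact mul_ne_zero hFx (pow_ne_zero _ hQx)
      positivity
    have hsub : ∀ x, eval x s = 0 → eval x g ≠ 0 → eval x (p1 * g) ≤ 0 →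
        1 ≤ R * eval x h → ∑ i, x i ^ 2 ≤ R → x ∈ K := by
      intro x k1 k2 k3 k4 k5
      refine ⟨k1, ?_, k4, k5⟩
      rw [hgx x k1] at k2
      rw [eval_mul, hgx x k1] at k3
      have hQx : eval x Q ≠ 0 := by intro hz; apply k2; rw [hz]; ring
      have hQ2 : 0 < eval x Q ^ 2 := by positivity
      by_contra hn
      rw [not_le] at hn
      have := mul_pos hn hQ2
      linarith
    rcases K.eq_empty_or_nonempty with hE | hne
    · refine ⟨1, one_pos, fun x k1 k2 k3 k4 k5 => ?_⟩
      have := hsub x k1 k2 k3 k4 k5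
      rw [hE] at this
      exact this.elim
    · obtain ⟨x0, hx0, hmin⟩ := hKc.exists_isMinOn hne (hcg.pow 2).continuousOn
      exact ⟨eval x0 g ^ 2, hKg x0 hx0, fun x k1 k2 k3 k4 k5 => hmin (hsub x k1 k2 k3 k4 k5)⟩)
  set M : MvPolynomial (Fin n) ℝ := (1 + C T * h + (∑ i, X i ^ 2) * h) ^ (N + 1) with hM
  refine ⟨h ^ (N + 1) * p1 + M * (1 + (g * p1) ^ 2) * g, fun x hx => ?_⟩
  have hxs : eval x s = 0 := (hs x).2 hx
  set a := eval x h with ha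
  set r := ∑ i, x i ^ 2 with hr
  have hr0 : 0 ≤ r := Finset.sum_nonneg (fun _ _ => sq_nonneg _)
  have hMx : eval x M = (1 + T * a + r * a) ^ (N + 1) := by simp [hM, ha, hr]
  have hpx : eval x (h ^ (N + 1) * p1 + M * (1 + (g * p1) ^ 2) * g) =
      a ^ (N+1) * eval x p1 + eval x M * (1 + (eval x g * eval x p1) ^ 2) * eval x g := by
    simp [ha]
  rw [hpx]
  have ha0 : 0 ≤ a := h0 x
  have hMpos : 0 < eval x M := by rw [hMx]; positivity
  set m := eval x M
  rcases eq_or_lt_of_le ha0 with hz | hpos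
  · have hFz : F x = 0 := (hI' x hxs).2 hz.symm
    rw [hgx x hxs, hFz, ← hz]; simp
  · have hFx : F x ≠ 0 := fun hzz => hpos.ne' ((hI' x hxs).1 hzz)
    have hapos : 0 < a ^ (N+1) := by positivity
    have hpos2 : 0 < 1 + (eval x g * eval x p1) ^ 2 := by positivity
    by_cases hQx : eval x Q = 0
    · have hg0 : eval x g = 0 := by rw [hgx x hxs, hQx]; ring
      rw [hg0, mul_zero, add_zero, sign_mul, sign_pos hapos, one_mul]
      exact hp1' x hxs hQx
    · have hQ2 : 0 < eval x Q ^ 2 := by positivity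
      have hsg : SignType.sign (F x) = SignType.sign (eval x g) := by
        rw [hgx x hxs, sign_mul, sign_pos hQ2, mul_one]
      have hgne : eval x g ≠ 0 := by rw [hgx x hxs]; exact mul_ne_zero hFx hQ2.ne'
      have hg2 : 0 < eval x g ^ 2 := by positivity
      rw [hsg]
      apply sign_eq_of_mul_pos
      set γ := eval x g
      set π := eval x p1
      have e1 : γ * (a ^ (N+1) * π + m * (1 + (γ * π) ^ 2) * γ) =
        a ^ (N+1) * (γ * π) + (m * γ ^ 2) * (1 + (γ * π) ^ 2) := by ring
      rw [e1]
      have hmg : 0 < m * γ ^ 2 := mul_pos hMpos hg2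
      by_cases hle : 0 < γ * π
      · have := mul_pos hapos hle
        have := mul_pos hmg hpos2
        linarith
      · rw [not_lt] at hle
        have hl := hloj (T + 1 / a + r) (by
          have : 0 < 1 / a := by positivity
          linarith) x hxs hgne (by rw [eval_mul]; linarith) (by
            rw [← ha]
            have : (T + 1 / a + r) * a = T * a + 1 + r * a := by field_simp
            rw [this]
            have := mul_nonneg (le_trans zero_le_one hT1) ha0
            have := mul_nonneg hr0 ha0
            linarith) (by
            have : 0 < 1 / a := by positivity
            linarith)
        set t := T + 1 / a + r with ht
        have ht1 : 1 ≤ t := by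
          have : 0 < 1 / a := by positivity
          linarith
        have h2 : 1 < t ^ (N+1) * γ ^ 2 := by
          have : t ^ N ≤ t ^ (N+1) := pow_le_pow_right₀ ht1 (Nat.le_succ N)
          have := mul_le_mul_of_nonneg_right this hg2.le
          linarith
        have h3 : m = t ^ (N+1) * a ^ (N+1) := by
          rw [hMx, ← mul_pow]; congr 1; rw [ht]; field_simp; ring
        have h4 : a ^ (N+1) < m * γ ^ 2 := by
          rw [h3]
          have := mul_lt_mul_of_pos_left h2 hapos
          linarith
        have h5 := mul_lt_mul_of_pos_right h4 hpos2
        have h6 : 0 ≤ 1 + (γ * π) ^ 2 + γ * π := by nlinarith [sq_nonneg (γ * π + 1)]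
        have h7 := mul_nonneg hapos.le h6
        nlinarith

lemma krull_le_of_integral {A S : Type*} [CommRing A] [CommRing S] [Algebra A S]
    [Algebra.IsIntegral A S] [FaithfulSMul A S] : ringKrullDim A ≤ ringKrullDim S := by
  rw [ringKrullDim, Order.krullDim]
  refine iSup_le (fun l => ?_)
  obtain ⟨P, hP, hPl⟩ := Ideal.nonempty_primesOver (S := S) (l.head).asIdeal
  obtain ⟨L, hL, -⟩ := Ideal.exists_ltSeries_of_hasGoingUp (S := S) l P
  rw [← hL]
  exact Order.LTSeries.length_le_krullDim L

lemma dim_ge_of_domain {d : ℕ} {S : Type} [CommRing S] [IsDomain S] [Algebra ℝ S]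
    [Algebra.FiniteType ℝ S] (φ : MvPolynomial (Fin d) ℝ →ₐ[ℝ] S) (hφ : Function.Injective φ) :
    (d : WithBot ℕ∞) ≤ ringKrullDim S := by
  obtain ⟨s, g, hg, hint⟩ := exists_integral_inj_algHom_of_fg ℝ S
  letI : Algebra (MvPolynomial (Fin s) ℝ) S := g.toRingHom.toAlgebra
  haveI : IsScalarTower ℝ (MvPolynomial (Fin s) ℝ) S := IsScalarTower.of_algHom g
  haveI : Algebra.IsIntegral (MvPolynomial (Fin s) ℝ) S := ⟨hint⟩
  haveI : FaithfulSMul (MvPolynomial (Fin s) ℝ) S :=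
    (faithfulSMul_iff_algebraMap_injective _ _).2 hg
  have h1 := krull_le_of_integral (A := MvPolynomial (Fin s) ℝ) (S := S)
  rw [MvPolynomial.ringKrullDim_of_isNoetherianRing, ringKrullDim_eq_zero_of_field] at h1
  have h2 : IsTranscendenceBasis ℝ (algebraMap (MvPolynomial (Fin s) ℝ) S ∘ X) :=
    (IsTranscendenceBasis.mvPolynomial (Fin s) ℝ).algebraMap_comp
  have h3 := h2.cardinalMk_eq_trdeg
  have h4 : AlgebraicIndependent ℝ (fun i => φ (X i)) := by
    rw [AlgebraicIndependent]
    convert hφ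
    ext i; simp
  have h5 := h4.cardinalMk_le_trdeg
  rw [← h3] at h5
  simp at h5
  refine le_trans ?_ h1
  simp
  exact_mod_cast h5

lemma dim_ge {d : ℕ} {S : Type} [CommRing S] [Algebra ℝ S]
    [Algebra.FiniteType ℝ S] (φ : MvPolynomial (Fin d) ℝ →ₐ[ℝ] S) (hφ : Function.Injective φ) :
    (d : WithBot ℕ∞) ≤ ringKrullDim S := by
  obtain ⟨P, hP, hPc⟩ := Ideal.exists_comap_eq_of_mem_minimalPrimes_of_injective
    (f := φ.toRingHom) hφ ⊥ (by rw [IsDomain.minimalPrimes_eq_singleton_bot]; rfl)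
  have h1 : Function.Injective ((Ideal.Quotient.mkₐ ℝ P).comp φ) := by
    rw [injective_iff_map_eq_zero]
    intro a ha
    have : φ a ∈ P := Ideal.Quotient.eq_zero_iff_mem.1 ha
    have : a ∈ Ideal.comap φ.toRingHom P := this
    rw [hPc] at this
    exact this
  refine le_trans (dim_ge_of_domain _ h1) ?_
  exact ringKrullDim_le_of_surjective (Ideal.Quotient.mk P) Ideal.Quotient.mk_surjective

noncomputable def gradL {n : ℕ} (x : Fin n → ℝ) (p : MvPolynomial (Fin n) ℝ) :
    (Fin n → ℝ) →L[ℝ] ℝ :=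
  ∑ i, eval x (pderiv i p) • ContinuousLinearMap.proj (R := ℝ) (φ := fun _ : Fin n => ℝ) i

lemma eval_strict {n : ℕ} (x : Fin n → ℝ) (p : MvPolynomial (Fin n) ℝ) :
    HasStrictFDerivAt (fun y => eval y p) (gradL x p) x := by
  induction p using MvPolynomial.induction_on with
  | C a =>
    have : gradL x (C a) = 0 := by simp [gradL]
    rw [this]
    simpa using hasStrictFDerivAt_const a x
  | add p q hp hq =>
    have : gradL x (p + q) = gradL x p + gradL x q := by
      simp [gradL, add_smul, Finset.sum_add_distrib]
    rw [this]
    have h := hp.add hq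
    have e : (fun y => eval y (p + q)) = ((fun y => eval y p) + fun y => eval y q) := by
      ext y; simp
    rw [e]; exact h
  | mul_X p i hp =>
    have h2 : HasStrictFDerivAt (fun y : Fin n → ℝ => y i)
      (ContinuousLinearMap.proj (R := ℝ) (φ := fun _ : Fin n => ℝ) i) x :=
      (ContinuousLinearMap.proj (R := ℝ) (φ := fun _ : Fin n => ℝ) i).hasStrictFDerivAt
    have h3 := hp.mul h2
    have : gradL x (p * X i) = eval x p • ContinuousLinearMap.proj (R := ℝ) (φ := fun _ : Fin n => ℝ) i
        + x i • gradL x p := by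
      ext v
      simp [gradL, pderiv_X, Pi.single_apply, add_mul, Finset.sum_add_distrib,
        Finset.mul_sum, apply_ite (eval x)]
      refine Finset.sum_congr rfl (fun j _ => by ring)
    rw [this]
    have e : (fun y => eval y (p * X i)) = ((fun y => eval y p) * fun y => y i) := by
      ext y; simp
    rw [e]; exact h3

lemma lin_ext {n m d : ℕ} (hd : m + d = n) (L : (Fin n → ℝ) →ₗ[ℝ] (Fin m → ℝ))
    (hL : Function.Surjective L) :
    ∃ π : (Fin n → ℝ) →ₗ[ℝ] (Fin d → ℝ), Function.Surjective (L.prod π) := by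
  have h1 := L.finrank_range_add_finrank_ker
  rw [LinearMap.range_eq_top.2 hL] at h1
  simp at h1
  have e : L.ker ≃ₗ[ℝ] (Fin d → ℝ) := LinearEquiv.ofFinrankEq _ _ (by simp; omega)
  obtain ⟨P, hP⟩ := LinearMap.exists_leftInverse_of_injective (L.ker.subtype) (by simp)
  refine ⟨e.toLinearMap ∘ₗ P, ?_⟩
  rintro ⟨a, b⟩
  obtain ⟨y, rfl⟩ := hL a
  have hP' : ∀ k : L.ker, P k = k := fun k => LinearMap.congr_fun hP k
  refine ⟨y + ((e.symm b - P y : L.ker) : Fin n → ℝ), ?_⟩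
  have hk : L ((e.symm b - P y : L.ker) : Fin n → ℝ) = 0 := (e.symm b - P y : L.ker).2
  ext1
  · rw [map_add]
    simp [LinearMap.prod_apply, hk]
  · simp only [LinearMap.prod_apply, Function.prod_apply, LinearMap.comp_apply, map_add, hP']
    simp

lemma open_image {n m d : ℕ} (hd : m + d = n) (p : Fin m → MvPolynomial (Fin n) ℝ)
    (x : Fin n → ℝ) (hx : ∀ j, eval x (p j) = 0)
    (hli : LinearIndependent ℝ fun j : Fin m => fun i : Fin n => eval x (pderiv i (p j))) :
    ∃ π : (Fin n → ℝ) →ₗ[ℝ] (Fin d → ℝ), ∀ W : Set (Fin n → ℝ), IsOpen W → x ∈ W →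
      π '' {y ∈ W | ∀ j, eval y (p j) = 0} ∈ nhds (π x) := by
  let M : Matrix (Fin m) (Fin n) ℝ := Matrix.of fun j i => eval x (pderiv i (p j))
  have hr : M.rank = m := by
    have := LinearIndependent.rank_matrix (M := M) hli
    simpa using this
  have hs : Function.Surjective M.mulVecLin := by
    rw [← LinearMap.range_eq_top]
    apply Submodule.eq_top_of_finrank_eq
    rw [Matrix.rank] at hr
    rw [hr]; simp
  obtain ⟨π, hπ⟩ := lin_ext hd _ hs
  refine ⟨π, fun W hW hxW => ?_⟩
  let πc : (Fin n → ℝ) →L[ℝ] (Fin d → ℝ) := LinearMap.toContinuousLinearMap π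
  have h1 : HasStrictFDerivAt (fun y => fun j => eval y (p j))
      (ContinuousLinearMap.pi fun j => gradL x (p j)) x :=
    hasStrictFDerivAt_pi.2 fun j => eval_strict x (p j)
  have h2 := h1.prodMk πc.hasStrictFDerivAt
  have hsurj : ((ContinuousLinearMap.pi fun j => gradL x (p j)).prod πc).range = ⊤ := by
    rw [LinearMap.range_eq_top]
    intro z
    obtain ⟨v, hv⟩ := hπ z
    refine ⟨v, ?_⟩
    rw [← hv]
    ext j
    · simp [gradL, M, Matrix.mulVec, dotProduct]
    · simp [πc]
  have h3 := h2.map_nhds_eq_of_surj hsurj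
  have h4 : (fun y => ((fun j => eval y (p j)), πc y)) '' W ∈
      nhds (((fun j => eval x (p j)), πc x) : (Fin m → ℝ) × (Fin d → ℝ)) := by
    rw [← h3]
    exact Filter.image_mem_map (hW.mem_nhds hxW)
  have h5 : Filter.Tendsto (fun z : Fin d → ℝ => (((fun j => eval x (p j)), z) : (Fin m → ℝ) × (Fin d → ℝ)))
      (nhds (π x)) (nhds ((fun j => eval x (p j)), πc x)) :=
    Continuous.tendsto (by fun_prop) _
  filter_upwards [h5 h4] with z hz
  obtain ⟨y, hy, hyz⟩ := hz
  have e1 := congrArg Prod.fst hyz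
  have e2 := congrArg Prod.snd hyz
  refine ⟨y, ⟨hy, fun j => ?_⟩, e2⟩
  have := congrFun e1 j
  simp only at this
  rw [this, hx]

lemma poly_zero_of_nhds {d : ℕ} (q : MvPolynomial (Fin d) ℝ) (a : Fin d → ℝ) (A : Set (Fin d → ℝ))
    (hA : A ∈ nhds a) (h : ∀ z ∈ A, eval z q = 0) : q = 0 := by
  refine MvPolynomial.funext (fun y => ?_)
  rw [map_zero]
  by_contra hy
  have h1 := line_ne q a y hy
  have h2 : Filter.Tendsto (fun t : ℝ => a + t • (y - a)) (nhdsWithin 0 {0}ᶜ) (nhds a) := by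
    have : Continuous (fun t : ℝ => a + t • (y - a)) := by fun_prop
    have h := this.tendsto 0
    simp only [zero_smul, add_zero] at h
    exact h.mono_left nhdsWithin_le_nhds
  obtain ⟨t, ht1, ht2⟩ := (h1.and (h2 hA)).exists
  exact ht1 (h _ ht2)

lemma alg_zero_inter {n : ℕ} {X : Set (Fin n → ℝ)} (hX : IsRealAlgebraicSet X)
    (q : MvPolynomial (Fin n) ℝ) : IsZariskiClosedIn X {x ∈ X | eval x q = 0} := by
  obtain ⟨k, p, rfl⟩ := hX
  refine ⟨⟨k + 1, Fin.cons q p, ?_⟩, fun x hx => hx.1⟩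
  ext x
  simp [Fin.forall_fin_succ, and_comm]

lemma vanishing_prime {n : ℕ} {X : Set (Fin n → ℝ)} (hX : IsIrreducibleAlgSet X)
    (hne : X.Nonempty) : (vanishingIdealOf X).IsPrime := by
  refine ⟨?_, ?_⟩
  · intro h
    obtain ⟨x, hx⟩ := hne
    have : (1 : MvPolynomial (Fin n) ℝ) ∈ vanishingIdealOf X := by rw [h]; trivial
    have := this x hx
    simp at this
  · intro a b hab
    rcases hX.2 _ _ (alg_zero_inter hX.1 a) (alg_zero_inter hX.1 b) (by
      ext x
      refine ⟨fun hx => ?_, fun hx => hx.elim (fun h => h.1) (fun h => h.1)⟩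
      have := hab x hx
      rw [map_mul] at this
      rcases mul_eq_zero.1 this with h | h
      · exact Or.inl ⟨hx, h⟩
      · exact Or.inr ⟨hx, h⟩) with h | h
    · left; intro x hx; rw [← h] at hx; exact hx.2
    · right; intro x hx; rw [← h] at hx; exact hx.2

lemma lemmaD {n : ℕ} {X : Set (Fin n → ℝ)} (hX : IsIrreducibleAlgSet X) (x : Fin n → ℝ)
    (hx : IsRegularPoint X x) (W : Set (Fin n → ℝ)) (hW : IsOpen W) (hxW : x ∈ W)
    (q : MvPolynomial (Fin n) ℝ) (hq : ∀ y ∈ X ∩ W, eval y q = 0) : ∀ y ∈ X, eval y q = 0 := by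
  obtain ⟨hxX, d, hd, p, U, hU, hxU, hXU, hli⟩ := hx
  have hprime := vanishing_prime hX ⟨x, hxX⟩
  by_contra hcon
  have hdn : d ≤ n := by
    have h1 := ringKrullDim_le_of_surjective (Ideal.Quotient.mk (vanishingIdealOf X))
      Ideal.Quotient.mk_surjective
    rw [MvPolynomial.ringKrullDim_of_isNoetherianRing, ringKrullDim_eq_zero_of_field] at h1
    rw [algDim] at hd
    rw [hd] at h1
    simp at h1
    exact_mod_cast h1
  have hx0 : ∀ j, eval x (p j) = 0 := by
    have : x ∈ X ∩ U := ⟨hxX, hxU⟩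
    rw [hXU] at this
    exact this.2
  obtain ⟨π, hπ⟩ := open_image (d := d) (by omega) p x hx0 hli
  have hA := hπ (W ∩ U) (hW.inter hU) ⟨hxW, hxU⟩
  let J := vanishingIdealOf (X ∩ W ∩ U)
  let ℓ : Fin d → MvPolynomial (Fin n) ℝ := fun i => ∑ k, C (π (Pi.single k 1) i) * MvPolynomial.X k
  have hℓ : ∀ y i, eval y (ℓ i) = π y i := by
    intro y i
    conv_rhs => rw [pi_eq_sum_univ' y]
    simp [ℓ, mul_comm]
  let φ : MvPolynomial (Fin d) ℝ →ₐ[ℝ] (MvPolynomial (Fin n) ℝ ⧸ J) :=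
    (Ideal.Quotient.mkₐ ℝ J).comp (aeval ℓ)
  have hφ : Function.Injective φ := by
    rw [injective_iff_map_eq_zero]
    intro a ha
    have ha' : aeval ℓ a ∈ J := Ideal.Quotient.eq_zero_iff_mem.1 ha
    refine poly_zero_of_nhds a _ _ hA ?_
    rintro _ ⟨y, ⟨⟨hyW, hyU⟩, hy⟩, rfl⟩
    have hyX : y ∈ X ∩ U := by rw [hXU]; exact ⟨hyU, hy⟩
    have := ha' y ⟨⟨hyX.1, hyW⟩, hyU⟩
    have e : eval y (aeval ℓ a) = eval (π y) a := by
      have : (eval y).comp ((aeval ℓ : MvPolynomial (Fin d) ℝ →ₐ[ℝ] _) : MvPolynomial (Fin d) ℝ →+* _)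
          = eval (π y) := by
        ext i <;> simp [hℓ]
      exact RingHom.congr_fun this a
    rw [← e, this]
  have h1 := dim_ge φ hφ
  have hle : vanishingIdealOf X ≤ J := fun r hr y hy => hr y hy.1.1
  have hqJ : q ∈ J := fun y hy => hq y hy.1
  have hqI : q ∉ vanishingIdealOf X := hcon
  have h2 := ringKrullDim_succ_le_of_surjective (Ideal.Quotient.factor hle)
    (Ideal.Quotient.factor_surjective hle) (r := Ideal.Quotient.mk _ q)
    (by
      rw [mem_nonZeroDivisors_iff_ne_zero]
      intro h
      exact hqI (Ideal.Quotient.eq_zero_iff_mem.1 h))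
    (by
      rw [Ideal.Quotient.factor_mk]
      exact Ideal.Quotient.eq_zero_iff_mem.2 hqJ)
  rw [algDim] at hd
  rw [hd] at h2
  have h3 : (d : WithBot ℕ∞) + 1 ≤ d := le_trans (by gcongr) h2
  have h4 : (d : ℕ) + 1 ≤ d := by exact_mod_cast h3
  omega

lemma key {n : ℕ} {X : Set (Fin n → ℝ)} (hX : IsIrreducibleAlgSet X) (hc : IsCentral X)
    (F : (Fin n → ℝ) → ℝ) (hF : IsRegulous F) (O : Set (Fin n → ℝ)) (hO : IsOpen O)
    (hne : (X ∩ O).Nonempty) (h0 : ∀ y ∈ X ∩ O, F y = 0) : ∀ y ∈ X, F y = 0 := by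
  obtain ⟨x0, hx0, hx0O⟩ := hne
  obtain ⟨P, Q, ⟨z, hz, hzQ⟩, hPQ⟩ := line_lemma F hF X ⟨x0, hx0⟩
  have hx0c : x0 ∈ closure {x | IsRegularPoint X x} := by rw [hc]; exact hx0
  obtain ⟨x, hxO, hx⟩ := mem_closure_iff.1 hx0c O hO hx0O
  have hP := lemmaD hX x hx O hO hxO P (fun y hy => by rw [← hPQ y hy.1, h0 y hy, zero_mul])
  have hreg : ∀ y, IsRegularPoint X y → F y = 0 := by
    intro y hy
    by_contra hFy
    have hopen : IsOpen {w | F w ≠ 0} := isOpen_ne_fun hF.1 continuous_const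
    refine hzQ (lemmaD hX y hy _ hopen hFy Q (fun w hw => ?_) z hz)
    have := hPQ w hw.1
    rw [hP w hw.1] at this
    exact (mul_eq_zero.1 this).resolve_left hw.2
  intro y hy
  have hcl : IsClosed {w | F w = 0} := isClosed_eq hF.1 continuous_const
  have hyc : y ∈ closure {x | IsRegularPoint X x} := by rw [hc]; exact hy
  exact closure_minimal (fun w hw => hreg w hw) hcl hyc

lemma real_sign_eq_iff (a b : ℝ) :
    Real.sign a = Real.sign b ↔ SignType.sign a = SignType.sign b := by
  rcases lt_trichotomy a 0 with ha | ha | ha <;> rcases lt_trichotomy b 0 with hb | hb | hb <;>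
    simp [ha, hb, Real.sign_of_neg, Real.sign_of_pos] <;> norm_num

lemma alg_sos {n : ℕ} {V : Set (Fin n → ℝ)} (hV : IsRealAlgebraicSet V) :
    ∃ h : MvPolynomial (Fin n) ℝ, (∀ x, 0 ≤ eval x h) ∧ ∀ x, x ∈ V ↔ eval x h = 0 := by
  obtain ⟨k, p, rfl⟩ := hV
  refine ⟨∑ i, p i ^ 2, fun x => ?_, fun x => ?_⟩
  · rw [map_sum]
    exact Finset.sum_nonneg (fun i _ => by rw [map_pow]; positivity)
  · rw [map_sum, Finset.sum_eq_zero_iff_of_nonneg (fun i _ => by rw [map_pow]; positivity)]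
    simp

lemma alg_single {n : ℕ} (s : MvPolynomial (Fin n) ℝ) :
    IsRealAlgebraicSet {x : Fin n → ℝ | eval x s = 0} :=
  ⟨1, fun _ => s, by simp⟩
/-- for a nonzero regulous function `f` on a central irreducible real algebraic
set `X`, the following are equivalent: (a) `sign f` is the sign of a polynomial function;
(b) `Z(f)` is Zariski closed; (c) `{f² > 0}` is principal open;
(d) `{f² > 0} ∩ Zar(Bd({f² > 0})) = ∅`. -/
theorem length_one_characterizations {n : ℕ} (X : Set (Fin n → ℝ))
    (hX : IsIrreducibleAlgSet X) (hc : IsCentral X)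
    (f : (Fin n → ℝ) → ℝ) (hf : IsRegulousOn X f) (hne : ∃ x ∈ X, f x ≠ 0) :
    ((∃ p : MvPolynomial (Fin n) ℝ,
        ∀ x ∈ X, Real.sign (f x) = Real.sign (MvPolynomial.eval x p)) ↔
      IsZariskiClosedIn X {x ∈ X | f x = 0}) ∧
    (IsZariskiClosedIn X {x ∈ X | f x = 0} ↔
      ∃ p : MvPolynomial (Fin n) ℝ,
        {x ∈ X | 0 < f x ^ 2} = {x ∈ X | 0 < MvPolynomial.eval x p}) ∧
    ((∃ p : MvPolynomial (Fin n) ℝ,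
        {x ∈ X | 0 < f x ^ 2} = {x ∈ X | 0 < MvPolynomial.eval x p}) ↔
      {x ∈ X | 0 < f x ^ 2} ∩
        zarClosureIn X (bdIn X {x ∈ X | 0 < f x ^ 2}) = ∅) := by
  obtain ⟨F, hF, hfF⟩ := hf
  have hXa := hX.1
  have hXne : X.Nonempty := hne.imp fun x hx => hx.1
  have hkey : ∀ O : Set (Fin n → ℝ), IsOpen O → (X ∩ O).Nonempty → (∀ y ∈ X ∩ O, f y = 0) →
      False := by
    intro O hO hn h
    obtain ⟨x, hx, hfx⟩ := hne
    apply hfx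
    rw [hfF x hx]
    exact key hX hc F hF O hO hn (fun y hy => by rw [← hfF y hy.1]; exact h y hy) x hx
  have hS : ∀ x, 0 < f x ^ 2 ↔ f x ≠ 0 := fun x => sq_pos_iff
  have ab : (∃ p : MvPolynomial (Fin n) ℝ,
        ∀ x ∈ X, Real.sign (f x) = Real.sign (MvPolynomial.eval x p)) →
      IsZariskiClosedIn X {x ∈ X | f x = 0} := by
    rintro ⟨p, hp⟩
    have : {x ∈ X | f x = 0} = {x ∈ X | eval x p = 0} := by
      ext x
      refine and_congr_right (fun hx => ?_)
      have := hp x hx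
      rw [← Real.sign_eq_zero_iff, this, Real.sign_eq_zero_iff]
    rw [this]
    exact alg_zero_inter hXa p
  have ba : IsZariskiClosedIn X {x ∈ X | f x = 0} → (∃ p : MvPolynomial (Fin n) ℝ,
        ∀ x ∈ X, Real.sign (f x) = Real.sign (MvPolynomial.eval x p)) := by
    rintro ⟨hZ, -⟩
    obtain ⟨h, h0, hh⟩ := alg_sos hZ
    obtain ⟨g, g0, hg⟩ := alg_sos hXa
    have hI : ∀ x, (∀ p ∈ vanishingIdealOf X, eval x p = 0) ↔ x ∈ X := by
      intro x
      refine ⟨fun hx => (hg x).2 (hx g fun y hy => (hg y).1 hy), fun hx p hp => hp x hx⟩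
    obtain ⟨p, hp⟩ := sep F hF h h0 (vanishingIdealOf X) (fun x hx => by
      have hx' := (hI x).1 hx
      rw [← hh x, ← hfF x hx']
      exact ⟨fun h => ⟨hx', h⟩, fun h => h.2⟩)
    refine ⟨p, fun x hx => ?_⟩
    rw [real_sign_eq_iff, hfF x hx]
    exact hp x ((hI x).2 hx)
  have bc : IsZariskiClosedIn X {x ∈ X | f x = 0} → ∃ p : MvPolynomial (Fin n) ℝ,
        {x ∈ X | 0 < f x ^ 2} = {x ∈ X | 0 < MvPolynomial.eval x p} := by
    rintro ⟨hZ, -⟩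
    obtain ⟨h, h0, hh⟩ := alg_sos hZ
    refine ⟨h, ?_⟩
    ext x
    refine and_congr_right (fun hx => ?_)
    rw [hS, (h0 x).lt_iff_ne', not_iff_not, ← hh x]
    exact ⟨fun h => ⟨hx, h⟩, fun h => h.2⟩
  have cb : (∃ p : MvPolynomial (Fin n) ℝ,
        {x ∈ X | 0 < f x ^ 2} = {x ∈ X | 0 < MvPolynomial.eval x p}) →
      IsZariskiClosedIn X {x ∈ X | f x = 0} := by
    rintro ⟨p, hp⟩
    have hp' : ∀ x ∈ X, (f x ≠ 0 ↔ 0 < eval x p) := by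
      intro x hx
      rw [← hS]
      have := Set.ext_iff.1 hp x
      exact ⟨fun h => (this.1 ⟨hx, h⟩).2, fun h => (this.2 ⟨hx, h⟩).2⟩
    have hnn : ∀ x ∈ X, 0 ≤ eval x p := by
      intro x hx
      by_contra hlt
      push Not at hlt
      refine hkey {y | eval y p < 0} (isOpen_lt (MvPolynomial.continuous_eval p) continuous_const)
        ⟨x, hx, hlt⟩ (fun y hy => ?_)
      by_contra hfy
      exact absurd ((hp' y hy.1).1 hfy) (not_lt.2 (le_of_lt hy.2))
    have : {x ∈ X | f x = 0} = {x ∈ X | eval x p = 0} := by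
      ext x
      refine and_congr_right (fun hx => ?_)
      rw [← not_iff_not, ← ne_eq, hp' x hx, (hnn x hx).lt_iff_ne']
    rw [this]
    exact alg_zero_inter hXa p
  have hXcl : IsClosed X := by
    have : IsClosed (closure {x | IsRegularPoint X x}) := isClosed_closure
    rwa [hc] at this
  have hint : ∀ x ∈ X, f x ≠ 0 → x ∈ interiorIn X {x ∈ X | 0 < f x ^ 2} := by
    intro x hx hfx
    refine ⟨hx, {y | F y ≠ 0}, isOpen_ne_fun hF.1 continuous_const, ?_, ?_⟩
    · rw [mem_ofPred_eq, ← hfF x hx]; exact hfx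
    · intro y hy
      refine ⟨hy.2, (hS y).2 ?_⟩
      rw [hfF y hy.2]; exact hy.1
  have hbd : bdIn X {x ∈ X | 0 < f x ^ 2} = {x ∈ X | f x = 0} := by
    ext x
    constructor
    · rintro ⟨⟨-, hx⟩, hi⟩
      refine ⟨hx, ?_⟩
      by_contra hfx
      exact hi (hint x hx hfx)
    · rintro ⟨hx, hfx⟩
      refine ⟨⟨?_, hx⟩, ?_⟩
      · rw [mem_closure_iff]
        intro O hO hxO
        by_contra hemp
        refine hkey O hO ⟨x, hx, hxO⟩ (fun y hy => ?_)
        by_contra hfy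
        exact hemp ⟨y, hy.2, hy.1, (hS y).2 hfy⟩
      · rintro ⟨-, U, hU, hxU, hsub⟩
        exact (hS x).1 (hsub ⟨hxU, hx⟩).2 hfx
  have bd : IsZariskiClosedIn X {x ∈ X | f x = 0} → {x ∈ X | 0 < f x ^ 2} ∩
        zarClosureIn X (bdIn X {x ∈ X | 0 < f x ^ 2}) = ∅ := by
    intro hZ
    rw [hbd, Set.eq_empty_iff_forall_notMem]
    rintro x ⟨hx, hx2⟩
    exact (hS x).1 hx.2 (hx2 _ ⟨hZ, subset_rfl⟩).2
  have db : {x ∈ X | 0 < f x ^ 2} ∩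
        zarClosureIn X (bdIn X {x ∈ X | 0 < f x ^ 2}) = ∅ →
      IsZariskiClosedIn X {x ∈ X | f x = 0} := by
    intro hd
    rw [hbd] at hd
    obtain ⟨s, hs⟩ := ideal_sos (vanishingIdealOf {x ∈ X | f x = 0})
    obtain ⟨g, g0, hg⟩ := alg_sos hXa
    have e : {x ∈ X | f x = 0} = {x | eval x s = 0} := by
      ext x
      constructor
      · intro hx
        exact (hs x).2 (fun p hp => hp x hx)
      · intro hx
        have hx1 := (hs x).1 hx
        have hxX : x ∈ X := (hg x).2 (hx1 g fun y hy => (hg y).1 hy.1)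
        refine ⟨hxX, ?_⟩
        by_contra hfx
        refine Set.eq_empty_iff_forall_notMem.1 hd x ⟨⟨hxX, (hS x).2 hfx⟩, ?_⟩
        rintro V ⟨⟨hV, -⟩, hZV⟩
        obtain ⟨v, v0, hv⟩ := alg_sos hV
        exact (hv x).2 (hx1 v fun y hy => (hv y).1 (hZV hy))
    refine ⟨?_, fun x hx => hx.1⟩
    rw [e]
    exact alg_single s
  exact ⟨⟨ab, ba⟩, ⟨bc, cb⟩, fun h => bd (cb h), fun h => bc (db h)⟩
end

section
/- Let X ⊆ ℝⁿ be a real algebraic set and let f be a continuous semi-algebraic function on X. Suppose there exist regulous functions g₁, g₂, g₃ on X such that {x ∈ X : f(x) > 0} = {x ∈ X : g₁(x) > 0}, {x ∈ X : f(x) < 0} = {x ∈ X : g₂(x) < 0}, and {x ∈ X : f(x) = 0} = {x ∈ X : g₃(x) = 0}. Then there exists a regulous function g on X such that sign(f)(x) = sign(g)(x) for all x ∈ X. -/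
open MvPolynomial Set

theorem aux_iff {n : ℕ} (f : (Fin n → ℝ) → ℝ) : IsRegulous f ↔ Continuous f ∧
    ∃ p q : MvPolynomial (Fin n) ℝ, q ≠ 0 ∧ ∀ x, MvPolynomial.eval x q ≠ 0 →
      f x = MvPolynomial.eval x p / MvPolynomial.eval x q := by
  constructor
  · rintro ⟨hc, U, ⟨-, k, r, hr⟩, ⟨a, ha⟩, p, q, hq, hf⟩
    refine ⟨hc, ?_⟩
    have h1 : a ∉ Set.univ \ U := fun h => h.2 ha
    rw [hr] at h1
    simp only [Set.mem_setOf_eq, not_forall] at h1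
    obtain ⟨i, hi⟩ := h1
    refine ⟨p * r i, q * r i, ?_, ?_⟩
    · intro h0
      have := congrArg (MvPolynomial.eval a) h0
      simp [hi, hq a ha] at this
    · intro x hx
      rw [map_mul] at hx
      have hrx := right_ne_zero_of_mul hx
      have hxU : x ∈ U := by
        by_contra hxU
        have : x ∈ Set.univ \ U := ⟨trivial, hxU⟩
        rw [hr] at this
        exact hrx (this i)
      rw [map_mul, map_mul, hf x hxU, mul_div_mul_right _ _ hrx]
  · rintro ⟨hc, p, q, hq, hf⟩
    refine ⟨hc, {x | MvPolynomial.eval x q ≠ 0}, ⟨Set.subset_univ _, 1, fun _ => q, ?_⟩, ?_,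
      p, q, fun x hx => hx, fun x hx => hf x hx⟩
    · ext x; simp
    · by_contra h
      apply hq
      apply MvPolynomial.funext
      intro x
      by_contra hx
      exact h ⟨x, by simpa using hx⟩

theorem aux_add {n : ℕ} {f g : (Fin n → ℝ) → ℝ} (hf : IsRegulous f) (hg : IsRegulous g) :
    IsRegulous (fun x => f x + g x) := by
  rw [aux_iff] at *
  obtain ⟨hc, p, q, hq, h⟩ := hf
  obtain ⟨hc', p', q', hq', h'⟩ := hg
  refine ⟨hc.add hc', p * q' + q * p', q * q', mul_ne_zero hq hq', fun x hx => ?_⟩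
  rw [map_mul] at hx
  have h1 := left_ne_zero_of_mul hx
  have h2 := right_ne_zero_of_mul hx
  rw [h x h1, h' x h2, div_add_div _ _ h1 h2]
  simp

theorem aux_mul {n : ℕ} {f g : (Fin n → ℝ) → ℝ} (hf : IsRegulous f) (hg : IsRegulous g) :
    IsRegulous (fun x => f x * g x) := by
  rw [aux_iff] at *
  obtain ⟨hc, p, q, hq, h⟩ := hf
  obtain ⟨hc', p', q', hq', h'⟩ := hg
  refine ⟨hc.mul hc', p * p', q * q', mul_ne_zero hq hq', fun x hx => ?_⟩
  rw [map_mul] at hx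
  rw [h x (left_ne_zero_of_mul hx), h' x (right_ne_zero_of_mul hx), div_mul_div_comm]
  simp

/-- if a continuous semi-algebraic function `f` on `X` has the same positivity
set, negativity set and zero set as (possibly different) regulous functions, then its sign is
the sign of a regulous function on `X`. -/
theorem sign_eq_sign_regulous {n : ℕ} (X : Set (Fin n → ℝ)) (hX : IsRealAlgebraicSet X)
    (f : (Fin n → ℝ) → ℝ) (hfc : ContinuousOn f X) (hfsa : IsSemialgebraicFnOn X f)
    (g₁ g₂ g₃ : (Fin n → ℝ) → ℝ)
    (hg₁ : IsRegulousOn X g₁) (hg₂ : IsRegulousOn X g₂) (hg₃ : IsRegulousOn X g₃)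
    (e₁ : {x ∈ X | 0 < f x} = {x ∈ X | 0 < g₁ x})
    (e₂ : {x ∈ X | f x < 0} = {x ∈ X | g₂ x < 0})
    (e₃ : {x ∈ X | f x = 0} = {x ∈ X | g₃ x = 0}) :
    ∃ g : (Fin n → ℝ) → ℝ, IsRegulousOn X g ∧
      ∀ x ∈ X, Real.sign (f x) = Real.sign (g x) := by
  obtain ⟨G₁, hG₁, E₁⟩ := hg₁
  obtain ⟨G₂, hG₂, E₂⟩ := hg₂
  obtain ⟨G₃, hG₃, E₃⟩ := hg₃
  refine ⟨fun x => g₃ x * g₃ x * (g₁ x + g₂ x),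
    ⟨fun x => G₃ x * G₃ x * (G₁ x + G₂ x), aux_mul (aux_mul hG₃ hG₃) (aux_add hG₁ hG₂),
      fun x hx => by simp only [E₁ x hx, E₂ x hx, E₃ x hx]⟩, fun x hx => ?_⟩
  have a₁ : 0 < f x ↔ 0 < g₁ x := by
    have := Set.ext_iff.1 e₁ x
    simpa [hx] using this
  have a₂ : f x < 0 ↔ g₂ x < 0 := by
    have := Set.ext_iff.1 e₂ x
    simpa [hx] using this
  have a₃ : f x = 0 ↔ g₃ x = 0 := by
    have := Set.ext_iff.1 e₃ x
    simpa [hx] using this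
  rcases lt_trichotomy (f x) 0 with h | h | h
  · have h1 : g₁ x ≤ 0 := not_lt.1 fun h' => absurd (a₁.2 h') (not_lt.2 h.le)
    have h2 := a₂.1 h
    have h3 : g₃ x ≠ 0 := fun h' => h.ne (a₃.2 h')
    rw [Real.sign_of_neg h, Real.sign_of_neg]
    exact mul_neg_of_pos_of_neg (mul_self_pos.2 h3) (by linarith)
  · simp [h, a₃.1 h]
  · have h1 := a₁.1 h
    have h2 : 0 ≤ g₂ x := not_lt.1 fun h' => absurd (a₂.2 h') (not_lt.2 h.le)
    have h3 : g₃ x ≠ 0 := fun h' => h.ne' (a₃.2 h')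
    rw [Real.sign_of_pos h, Real.sign_of_pos]
    exact mul_pos (mul_self_pos.2 h3) (by linarith)
end
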